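/- arXiv:1801.06078 — 2 statements merged into one kernel-verified Lean document; each statement's English description precedes it below -/
import Mathlib

section
/- Let (W,S) be a finite Coxeter system of rank n with standard Coxeter element c. For every w ∈ NC(W,c) of rank r = ℓ_T(w), the lower ideal {v ∈ NC(W,c) : v ⊏ w} for the order ⊏ is a Boolean lattice with 2^r elements; in particular the number of intervals of height k for ⊏ in NC(W,c) equals ∑_{r=k}^{n} Nar_r(W) · C(r,k), where Nar_r(W) is the number of elements of NC(W,c) of rank r. -/
namespace NCpaper

open CoxeterSystem

variable {B : Type*} {W : Type*} [Group W] {M : CoxeterMatrix B}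

/-- The absolute length: minimal length of a factorization into reflections. -/
noncomputable def absLength (cs : CoxeterSystem M W) (w : W) : ℕ :=
  sInf {k | ∃ l : List W, (∀ t ∈ l, cs.IsReflection t) ∧ l.length = k ∧ l.prod = w}

/-- The absolute order: `v ≤ w` iff `ℓ_T w = ℓ_T (v⁻¹ w) + ℓ_T v`. -/
noncomputable def AbsLe (cs : CoxeterSystem M W) (v w : W) : Prop :=
  absLength cs w = absLength cs (v⁻¹ * w) + absLength cs v

/-- Cover relation of the absolute order. -/
noncomputable def AbsCovBy (cs : CoxeterSystem M W) (v w : W) : Prop :=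
  cs.IsReflection (v⁻¹ * w) ∧ absLength cs w = absLength cs v + 1

/-- Generating relation of the Bruhat order: multiply by a reflection, length goes up. -/
def BruhatGen (cs : CoxeterSystem M W) (v w : W) : Prop :=
  cs.IsReflection (v⁻¹ * w) ∧ cs.length v < cs.length w

/-- The Bruhat order. -/
def BruhatLe (cs : CoxeterSystem M W) : W → W → Prop := Relation.ReflTransGen (BruhatGen cs)

/-- The strict Bruhat order. -/
def BruhatLt (cs : CoxeterSystem M W) : W → W → Prop := Relation.TransGen (BruhatGen cs)

/-- The support of an element: simple reflections occurring in every (equivalently, some)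
reduced word for it. -/
def supp (cs : CoxeterSystem M W) (w : W) : Set B :=
  {i | ∀ l : List B, cs.IsReduced l → cs.wordProd l = w → i ∈ l}

/-- A standard Coxeter element: the product of all the simple reflections, each once,
in some order. -/
def IsStdCoxeterElement (cs : CoxeterSystem M W) (c : W) : Prop :=
  ∃ l : List B, l.Nodup ∧ (∀ i : B, i ∈ l) ∧ cs.wordProd l = c

/-- Generating relation for the order `⊏`: an absolute-order cover which is Bruhat-increasing. -/
noncomputable def SqGen (cs : CoxeterSystem M W) (v w : W) : Prop :=
  AbsCovBy cs v w ∧ BruhatLt cs v w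

/-- The order `⊏`. -/
noncomputable def Sq (cs : CoxeterSystem M W) : W → W → Prop :=
  Relation.ReflTransGen (SqGen cs)

/-- Generating relation for the order `≪`: an absolute-order cover which is Bruhat-decreasing. -/
noncomputable def LlGen (cs : CoxeterSystem M W) (v w : W) : Prop :=
  AbsCovBy cs v w ∧ BruhatLt cs w v

/-- The order `≪`. -/
noncomputable def Ll (cs : CoxeterSystem M W) : W → W → Prop :=
  Relation.ReflTransGen (LlGen cs)



set_option linter.unusedSectionVars false


section GeomRep

open Classical in
/-- simple root -/
noncomputable def sr (i : B) : B → ℝ := Pi.single i 1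

/-- simple coroot -/
noncomputable def scr [Fintype B] (M : CoxeterMatrix B) (i : B) : Module.Dual ℝ (B → ℝ) :=
  ∑ b, (-2 * Real.cos (Real.pi / (M i b : ℝ))) • LinearMap.proj b

lemma scr_sr [Fintype B] (M : CoxeterMatrix B) (i j : B) :
    scr M i (sr j) = -2 * Real.cos (Real.pi / (M i j : ℝ)) := by
  classical
  simp [scr, sr, Pi.single_apply]

lemma scr_self [Fintype B] (M : CoxeterMatrix B) (i : B) : scr M i (sr i) = 2 := by
  rw [scr_sr]; simp

noncomputable def sigma [Fintype B] (M : CoxeterMatrix B) (i : B) : (B → ℝ) ≃ₗ[ℝ] (B → ℝ) :=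
  Module.reflection (scr_self M i)

lemma S_eval (φ : ℝ) (k : ℤ) :
    ((Polynomial.Chebyshev.S ℝ k).eval (2 * Real.cos φ)) * Real.sin φ = Real.sin ((k + 1) * φ) := by
  have := Polynomial.Chebyshev.S_eq_U_comp_half_mul_X ℝ k
  rw [this]
  simp only [Polynomial.eval_comp, Polynomial.eval_mul, Polynomial.eval_C, Polynomial.eval_X]
  have h2 : (⅟2 : ℝ) * (2 * Real.cos φ) = Real.cos φ := by simp
  rw [h2, Polynomial.Chebyshev.U_real_cos]

lemma braid_aux {V : Type*} [AddCommGroup V] [Module ℝ V] {x y : V} {f g : Module.Dual ℝ V}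
    (hf : f x = 2) (hg : g y = 2) (m : ℕ) (hm : 3 ≤ m)
    (hfy : f y = -2 * Real.cos (Real.pi / m)) (hgx : g x = -2 * Real.cos (Real.pi / m)) :
    (Module.reflection hf * Module.reflection hg) ^ m = 1 := by
  ext z
  have hm0 : (0:ℝ) < m := by positivity
  set φ : ℝ := 2 * (Real.pi / m) with hφ
  have ht : 2 * Real.cos φ = f y * g x - 2 := by
    rw [hfy, hgx, hφ, Real.cos_two_mul]; ring
  have hs : Real.sin φ ≠ 0 := by
    apply ne_of_gt
    apply Real.sin_pos_of_pos_of_lt_pi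
    · positivity
    · rw [hφ, ← mul_div_assoc, div_lt_iff₀ hm0]
      have : (3:ℝ) ≤ m := by exact_mod_cast hm
      nlinarith [Real.pi_pos]
  rw [Module.reflection_mul_reflection_pow_apply hf hg m z _ ht]
  obtain ⟨k, hk | hk⟩ := Nat.even_or_odd' m
  · have e1 : ((m:ℤ) - 2) / 2 = k - 1 := by omega
    have e2 : ((m:ℤ) - 1) / 2 = k - 1 := by omega
    have : (Polynomial.Chebyshev.S ℝ (k - 1)).eval (2 * Real.cos φ) = 0 := by
      have h := S_eval φ (k - 1)
      have : (((k - 1 : ℤ) : ℝ) + 1) * φ = Real.pi := by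
        push_cast
        rw [hφ, hk]; push_cast
        have : (k:ℝ) ≠ 0 := by rintro h; norm_cast at h; omega
        field_simp
        ring
      rw [this, Real.sin_pi] at h
      exact (mul_eq_zero.mp h).resolve_right hs
    rw [e1, e2, this]; simp
  · have e1 : ((m:ℤ) - 2) / 2 = k - 1 := by omega
    have e2 : ((m:ℤ) - 1) / 2 = k := by omega
    have e3 : ((m:ℤ) - 3) / 2 = k - 1 := by omega
    have e4 : (m:ℤ) / 2 = k := by omega
    have : (Polynomial.Chebyshev.S ℝ k).eval (2 * Real.cos φ) +
        (Polynomial.Chebyshev.S ℝ (k - 1)).eval (2 * Real.cos φ) = 0 := by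
      have h := S_eval φ (k - 1)
      have h' := S_eval φ k
      have : Real.sin ((((k : ℤ) : ℝ) + 1) * φ) = - Real.sin ((((k - 1 : ℤ) : ℝ) + 1) * φ) := by
        rw [← Real.sin_neg, ← Real.sin_add_two_pi (-_)]
        congr 1
        push_cast
        have h1 : (m:ℝ) = 2 * k + 1 := by rw [hk]; push_cast; ring
        have : (2 * k + 1:ℝ) ≠ 0 := by positivity
        rw [hφ, h1]
        field_simp
        ring
      have h3 : ((Polynomial.Chebyshev.S ℝ k).eval (2 * Real.cos φ) +
        (Polynomial.Chebyshev.S ℝ (k - 1)).eval (2 * Real.cos φ)) * Real.sin φ = 0 := by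
        rw [add_mul, h, h', this]; ring
      exact (mul_eq_zero.mp h3).resolve_right hs
    rw [e1, e2, e3, e4, this]; simp

lemma sigma_liftable [Fintype B] (M : CoxeterMatrix B) : M.IsLiftable (sigma M) := by
  intro i j
  rcases Nat.lt_or_ge 2 (M i j) with h | h
  · exact braid_aux _ _ _ h (scr_sr M i j) (by rw [scr_sr, M.symmetric])
  · by_cases hij : i = j
    · subst hij
      rw [M.diagonal, pow_one]
      ext z : 1
      exact Module.involutive_reflection (scr_self M i) z
    · have h1 := M.off_diagonal i j hij
      have h2 : M i j = 0 ∨ M i j = 2 := by omega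
      rcases h2 with h2 | h2
      · rw [h2, pow_zero]
      · rw [h2]
        apply LinearEquiv.ext
        intro z
        have a1 : scr M i (sr j) = 0 := by rw [scr_sr, h2]; simp
        have a2 : scr M j (sr i) = 0 := by rw [scr_sr, M.symmetric, h2]; simp
        rw [pow_two]
        simp only [LinearEquiv.mul_apply, sigma, Module.reflection_apply, map_sub, map_smul, a1, a2,
          scr_self]
        simp
        module

/-- the geometric representation -/
noncomputable def rho [Fintype B] (cs : CoxeterSystem M W) : W →* ((B → ℝ) ≃ₗ[ℝ] (B → ℝ)) :=
  cs.lift ⟨sigma M, sigma_liftable M⟩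

lemma rho_simple [Fintype B] (cs : CoxeterSystem M W) (i : B) (x : B → ℝ) :
    rho cs (cs.simple i) x = x - scr M i x • sr i := by
  rw [rho, cs.lift_apply_simple]
  exact Module.reflection_apply _ _

/-- `sin (k π / m) / sin (π/m)` -/
noncomputable def cS (θ : ℝ) (k : ℕ) : ℝ :=
  (Polynomial.Chebyshev.S ℝ ((k : ℤ) - 1)).eval (2 * Real.cos θ)

lemma cS_zero (θ : ℝ) : cS θ 0 = 0 := by simp [cS]
lemma cS_one (θ : ℝ) : cS θ 1 = 1 := by simp [cS]
lemma cS_add_two (θ : ℝ) (k : ℕ) : cS θ (k + 2) = 2 * Real.cos θ * cS θ (k + 1) - cS θ k := by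
  have := Polynomial.Chebyshev.S_add_two ℝ ((k:ℤ) - 1)
  simp only [cS]
  have e1 : (((k + 2 : ℕ) : ℤ) - 1) = (k:ℤ) - 1 + 2 := by push_cast; ring
  have e2 : (((k + 1 : ℕ) : ℤ) - 1) = (k:ℤ) - 1 + 1 := by push_cast; ring
  rw [e1, e2, this]; simp

lemma cS_nonneg (m k : ℕ) (hm : m ≠ 1) (h : m ≠ 0 → k ≤ m) : 0 ≤ cS (Real.pi / m) k := by
  by_cases h0 : m = 0
  · subst h0
    have : ∀ k : ℕ, cS (Real.pi / (0:ℕ)) k = k ∧ cS (Real.pi / (0:ℕ)) (k+1) = k + 1 := by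
      intro k
      induction k with
      | zero => simp [cS_zero, cS_one]
      | succ k ih =>
        refine ⟨by rw [ih.2]; push_cast; ring, ?_⟩
        rw [cS_add_two, ih.1, ih.2]; simp; ring
    rw [(this k).1]; positivity
  · have h := h h0
    have hm2 : 2 ≤ m := by omega
    have hm0 : (0:ℝ) < m := by positivity
    have hs : 0 < Real.sin (Real.pi / m) := by
      apply Real.sin_pos_of_pos_of_lt_pi (by positivity)
      rw [div_lt_iff₀ hm0]
      have : (2:ℝ) ≤ m := by exact_mod_cast hm2
      nlinarith [Real.pi_pos]
    have h1 := S_eval (Real.pi / m) ((k:ℤ) - 1)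
    have h2 : 0 ≤ Real.sin ((((k:ℤ) - 1 : ℤ) + 1 : ℝ) * (Real.pi / m)) := by
      apply Real.sin_nonneg_of_nonneg_of_le_pi
      · push_cast; simp; positivity
      · push_cast
        rw [← mul_div_assoc, div_le_iff₀ hm0]
        have : (k:ℝ) ≤ m := by exact_mod_cast h
        nlinarith [Real.pi_pos]
    rw [← h1] at h2
    exact nonneg_of_mul_nonneg_left h2 hs

lemma rho_alt [Fintype B] (cs : CoxeterSystem M W) (i j : B) (k : ℕ) :
    rho cs (cs.wordProd (alternatingWord i j k)) (sr i) =
      if Even k then cS (Real.pi / M i j) (k+1) • sr i + cS (Real.pi / M i j) k • sr j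
      else cS (Real.pi / M i j) k • sr i + cS (Real.pi / M i j) (k+1) • sr j := by
  induction k with
  | zero => simp [alternatingWord, cS_zero, cS_one]
  | succ k ih =>
    rw [alternatingWord_succ', cs.wordProd_cons, map_mul, LinearEquiv.mul_apply, ih]
    by_cases hk : Even k
    · have hk' : ¬ Even (k+1) := by simpa [Nat.even_add_one] using hk
      simp only [hk, hk', if_true, if_false]
      rw [rho_simple, map_add, map_smul, map_smul, scr_self, scr_sr, M.symmetric j i, cS_add_two]
      simp only [smul_eq_mul]
      module
    · have hk' : Even (k+1) := by simpa [Nat.even_add_one] using hk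
      simp only [hk, hk', if_true, if_false]
      rw [rho_simple, map_add, map_smul, map_smul, scr_self, scr_sr, cS_add_two]
      simp only [smul_eq_mul]
      module

/-- nonnegative coordinates -/
def Pos (x : B → ℝ) : Prop := ∀ b, 0 ≤ x b

lemma Pos.add {x y : B → ℝ} (hx : Pos x) (hy : Pos y) : Pos (x + y) :=
  fun b => add_nonneg (hx b) (hy b)
lemma Pos.smul {x : B → ℝ} {a : ℝ} (ha : 0 ≤ a) (hx : Pos x) : Pos (a • x) :=
  fun b => mul_nonneg ha (hx b)
lemma pos_sr (i : B) : Pos (sr i) := by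
  classical
  intro b; simp only [sr, Pi.single_apply]; split_ifs <;> simp

/-- Main positivity theorem. -/
theorem rho_pos [Fintype B] (cs : CoxeterSystem M W) (w : W) (i : B)
    (h : ¬ cs.IsRightDescent w i) : Pos (rho cs w (sr i)) := by
  induction hn : cs.length w using Nat.strong_induction_on generalizing w i with
  | _ n ih =>
  subst hn
  by_cases hw : w = 1
  · subst hw; simpa using pos_sr i
  obtain ⟨j, hj⟩ := cs.exists_rightDescent_of_ne_one hw
  have hij : i ≠ j := by rintro rfl; exact h hj
  rw [cs.not_isRightDescent_iff] at h
  rw [cs.isRightDescent_iff] at hj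
  -- maximal k
  let P : ℕ → Prop := fun k => ∃ v : W, w = v * cs.wordProd (alternatingWord i j k) ∧
    cs.length w = cs.length v + k
  have hP1 : P 1 := ⟨w * cs.simple j, by simp [alternatingWord], by omega⟩
  have hbd : ∀ k, P k → k ≤ cs.length w := by rintro k ⟨v, -, h⟩; omega
  obtain ⟨k, hk, hmax⟩ : ∃ k, P k ∧ ∀ k', P k' → k' ≤ k := by
    classical
    refine ⟨Nat.findGreatest P (cs.length w), ?_, ?_⟩
    · exact Nat.findGreatest_spec (hbd 1 hP1) hP1
    · intro k' hk'; exact Nat.le_findGreatest (hbd _ hk') hk'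
  have hk1 : 1 ≤ k := hmax 1 hP1
  obtain ⟨v, hv, hl⟩ := hk
  -- descents of v
  obtain ⟨k', rfl⟩ : ∃ k', k = k' + 1 := ⟨k - 1, by omega⟩
  have hfirst : ¬ cs.IsRightDescent v (if Even k' then j else i) := by
    intro hd
    rw [cs.isRightDescent_iff] at hd
    rw [alternatingWord_succ', cs.wordProd_cons, ← mul_assoc] at hv
    have h1 := cs.length_mul_le (v * cs.simple (if Even k' then j else i))
      (cs.wordProd (alternatingWord i j k'))
    rw [← hv] at h1
    have h2 := cs.length_wordProd_le (alternatingWord i j k')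
    rw [length_alternatingWord] at h2
    omega
  have hsecond : ¬ cs.IsRightDescent v (if Even (k'+1) then j else i) := by
    intro hd
    rw [cs.isRightDescent_iff] at hd
    have : P (k' + 1 + 1) := by
      refine ⟨v * cs.simple (if Even (k'+1) then j else i), ?_, by omega⟩
      rw [alternatingWord_succ' i j (k'+1), cs.wordProd_cons, ← mul_assoc]
      simpa using hv
    have := hmax _ this
    omega
  have hvij : ¬ cs.IsRightDescent v i ∧ ¬ cs.IsRightDescent v j := by
    by_cases hk : Even k'
    · have hk' : ¬ Even (k'+1) := by simpa [Nat.even_add_one] using hk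
      rw [if_pos hk] at hfirst; rw [if_neg hk'] at hsecond
      exact ⟨hsecond, hfirst⟩
    · have hk' : Even (k'+1) := by simpa [Nat.even_add_one] using hk
      rw [if_neg hk] at hfirst; rw [if_pos hk'] at hsecond
      exact ⟨hfirst, hsecond⟩
  have pi := ih (cs.length v) (by omega) v i hvij.1 rfl
  have pj := ih (cs.length v) (by omega) v j hvij.2 rfl
  have hM1 : M i j ≠ 1 := M.off_diagonal i j hij
  have hkm : M i j ≠ 0 → k' + 1 + 1 ≤ M i j := by
    intro hm0
    by_contra hcon
    -- the word of length k'+2 ending in i is then too short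
    have e : w * cs.simple i = v * cs.wordProd (alternatingWord j i (k' + 1 + 1)) := by
      rw [alternatingWord_succ j i, cs.wordProd_concat, ← mul_assoc, ← hv]
    have hlen : cs.length (cs.wordProd (alternatingWord j i (k' + 1 + 1))) < k' + 1 + 1 := by
      have := cs.not_isReduced_alternatingWord j i (m := k' + 1 + 1)
        (by rw [M.symmetric]; exact hm0) (by rw [M.symmetric]; omega)
      have h2 := cs.length_wordProd_le (alternatingWord j i (k' + 1 + 1))
      rw [CoxeterSystem.IsReduced] at this
      rw [length_alternatingWord] at h2 this
      omega
    have := cs.length_mul_le v (cs.wordProd (alternatingWord j i (k' + 1 + 1)))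
    rw [← e] at this
    omega
  have c1 : 0 ≤ cS (Real.pi / M i j) (k'+1) := cS_nonneg _ _ hM1 (fun h => by have := hkm h; omega)
  have c2 : 0 ≤ cS (Real.pi / M i j) (k'+1+1) := cS_nonneg _ _ hM1 hkm
  rw [hv, map_mul, LinearEquiv.mul_apply, rho_alt]
  split_ifs
  · rw [map_add, map_smul, map_smul]; exact (pi.smul c2).add (pj.smul c1)
  · rw [map_add, map_smul, map_smul]; exact (pi.smul c1).add (pj.smul c2)

end GeomRep


section Form

variable [Fintype B] [Finite W] (cs : CoxeterSystem M W)

/-- invariant inner product -/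
noncomputable def F : (B → ℝ) →ₗ[ℝ] (B → ℝ) →ₗ[ℝ] ℝ :=
  letI := Fintype.ofFinite W
  LinearMap.mk₂ ℝ (fun x y => ∑ w : W, ∑ b, rho cs w x b * rho cs w y b)
    (by intro x x' y; simp [add_mul, Finset.sum_add_distrib])
    (by intro a x y; simp [Finset.mul_sum, mul_assoc])
    (by intro x y y'; simp [mul_add, Finset.sum_add_distrib])
    (by intro a x y; simp [Finset.mul_sum, mul_left_comm])

lemma F_symm (x y : B → ℝ) : F cs x y = F cs y x := by
  simp [F, LinearMap.mk₂_apply, mul_comm]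

lemma F_pos {x : B → ℝ} (hx : x ≠ 0) : 0 < F cs x x := by
  let _ := Fintype.ofFinite W
  simp only [F, LinearMap.mk₂_apply]
  have h0 : ∀ w : W, 0 ≤ ∑ b, rho cs w x b * rho cs w x b :=
    fun w => Finset.sum_nonneg fun b _ => mul_self_nonneg _
  apply Finset.sum_pos' (fun w _ => h0 w)
  refine ⟨1, Finset.mem_univ _, ?_⟩
  obtain ⟨b, hb⟩ := Function.ne_iff.mp hx
  apply Finset.sum_pos' (fun b _ => mul_self_nonneg _)
  exact ⟨b, Finset.mem_univ _, by simpa using hb⟩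

lemma F_inv (w : W) (x y : B → ℝ) : F cs (rho cs w x) (rho cs w y) = F cs x y := by
  let _ := Fintype.ofFinite W
  simp only [F, LinearMap.mk₂_apply, ← LinearEquiv.mul_apply, ← map_mul]
  exact Fintype.sum_equiv (Equiv.mulRight w) _ _ (fun _ => rfl)

lemma F_eq_zero {x : B → ℝ} (h : F cs x x = 0) : x = 0 := by
  by_contra hx
  exact (F_pos cs hx).ne' h

/-- orthogonal reflection -/
noncomputable def refl (β x : B → ℝ) : B → ℝ := x - (2 * F cs x β / F cs β β) • β

lemma sr_ne (i : B) : (sr i : B → ℝ) ≠ 0 := by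
  classical
  simp [sr]

lemma rho_simple_self (i : B) : rho cs (cs.simple i) (sr i) = - sr i := by
  rw [rho_simple, scr_self]; module

lemma rho_simple_refl (i : B) (x : B → ℝ) : rho cs (cs.simple i) x = refl cs (sr i) x := by
  have h1 := F_inv cs (cs.simple i) x (sr i)
  rw [rho_simple_self, rho_simple] at h1
  simp only [map_neg, map_sub, map_smul, LinearMap.sub_apply, LinearMap.smul_apply,
    smul_eq_mul] at h1
  rw [rho_simple, refl]
  congr 2
  have := F_pos cs (sr_ne i)
  field_simp
  linarith

lemma refl_rho (w : W) (β x : B → ℝ) :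
    refl cs (rho cs w β) (rho cs w x) = rho cs w (refl cs β x) := by
  simp [refl, F_inv]

lemma refl_smul (β x : B → ℝ) {a : ℝ} (ha : a ≠ 0) : refl cs (a • β) x = refl cs β x := by
  by_cases hb : β = 0
  · simp [hb, refl]
  have := F_pos cs hb
  simp only [refl, map_smul, LinearMap.smul_apply, smul_eq_mul, smul_smul]
  congr 2
  field_simp

lemma rho_one (x : B → ℝ) : rho cs 1 x = x := by simp
lemma rho_mul (v w : W) (x : B → ℝ) : rho cs (v * w) x = rho cs v (rho cs w x) := by simp
lemma rho_inv_self (w : W) (x : B → ℝ) : rho cs w (rho cs w⁻¹ x) = x := by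
  rw [← rho_mul]; simp
lemma rho_self_inv (w : W) (x : B → ℝ) : rho cs w⁻¹ (rho cs w x) = x := by
  rw [← rho_mul]; simp

/-- roots -/
def IsRoot (β : B → ℝ) : Prop := ∃ w i, β = rho cs w (sr i)

variable {cs}

lemma IsRoot.ne {β : B → ℝ} (h : IsRoot cs β) : β ≠ 0 := by
  obtain ⟨w, i, rfl⟩ := h
  simpa using sr_ne i

lemma IsRoot.map {β : B → ℝ} (h : IsRoot cs β) (w : W) : IsRoot cs (rho cs w β) := by
  obtain ⟨v, i, rfl⟩ := h
  exact ⟨w * v, i, by simp⟩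

lemma isRoot_sr (i : B) : IsRoot cs (sr i) := ⟨1, i, by simp⟩

lemma IsRoot.neg {β : B → ℝ} (h : IsRoot cs β) : IsRoot cs (-β) := by
  obtain ⟨w, i, rfl⟩ := h
  exact ⟨w * cs.simple i, i, by rw [rho_mul, rho_simple_self]; simp⟩

lemma IsRoot.pos_or {β : B → ℝ} (h : IsRoot cs β) : Pos β ∨ Pos (-β) := by
  obtain ⟨w, i, rfl⟩ := h
  by_cases hd : cs.IsRightDescent w i
  · right
    rw [cs.isRightDescent_iff_not_isRightDescent_mul] at hd
    have := rho_pos cs _ _ hd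
    rwa [rho_mul, rho_simple_self, map_neg] at this
  · exact Or.inl (rho_pos cs w i hd)

lemma Pos.eq_zero {x : B → ℝ} (h : Pos x) (h' : Pos (-x)) : x = 0 := by
  funext b
  have := h b; have := h' b
  simp at *; linarith

variable (cs) in
lemma rho_faithful {w : W} (h : ∀ x, rho cs w x = x) : w = 1 := by
  by_contra hw
  obtain ⟨i, hi⟩ := cs.exists_rightDescent_of_ne_one hw
  rw [cs.isRightDescent_iff_not_isRightDescent_mul] at hi
  have := rho_pos cs _ _ hi
  rw [rho_mul, rho_simple_self, map_neg, h] at this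
  exact sr_ne i ((pos_sr i).eq_zero this)

variable (cs) in
lemma rho_inj {v w : W} (h : ∀ x, rho cs v x = rho cs w x) : v = w := by
  have : v⁻¹ * w = 1 := rho_faithful cs (fun x => by rw [rho_mul, ← h, rho_self_inv])
  exact inv_mul_eq_one.mp this

open Classical in
variable (cs) in
/-- group element of the reflection in a root -/
noncomputable def tt (β : B → ℝ) : W :=
  if h : ∃ t : W, cs.IsReflection t ∧ ∀ x, rho cs t x = refl cs β x then h.choose else 1

variable (cs) in
lemma rho_conj (w : W) (i : B) (x : B → ℝ) :
    rho cs (w * cs.simple i * w⁻¹) x = refl cs (rho cs w (sr i)) x := by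
  rw [rho_mul, rho_mul, rho_simple_refl, ← refl_rho, rho_inv_self]

lemma IsRoot.tt_spec {β : B → ℝ} (h : IsRoot cs β) :
    cs.IsReflection (tt cs β) ∧ ∀ x, rho cs (tt cs β) x = refl cs β x := by
  have h' : ∃ t : W, cs.IsReflection t ∧ ∀ x, rho cs t x = refl cs β x := by
    obtain ⟨w, i, rfl⟩ := h
    exact ⟨w * cs.simple i * w⁻¹, ⟨w, i, rfl⟩, rho_conj cs w i⟩
  rw [tt, dif_pos h']
  exact h'.choose_spec

lemma IsRoot.rho_tt {β : B → ℝ} (h : IsRoot cs β) (x : B → ℝ) :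
    rho cs (tt cs β) x = refl cs β x := h.tt_spec.2 x

lemma tt_eq {β : B → ℝ} (h : IsRoot cs β) {t : W} (ht : ∀ x, rho cs t x = refl cs β x) :
    tt cs β = t := rho_inj cs (fun x => by rw [h.rho_tt, ht])

lemma tt_sr (i : B) : tt cs (sr i) = cs.simple i :=
  tt_eq (isRoot_sr i) (rho_simple_refl cs i)

lemma tt_map {β : B → ℝ} (h : IsRoot cs β) (w : W) :
    tt cs (rho cs w β) = w * tt cs β * w⁻¹ :=
  tt_eq (h.map w) (fun x => by rw [rho_mul, rho_mul, h.rho_tt, ← refl_rho, rho_inv_self])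

lemma tt_smul {β β' : B → ℝ} (h : IsRoot cs β) (h' : IsRoot cs β') {a : ℝ} (e : β = a • β') :
    tt cs β = tt cs β' := by
  apply tt_eq h
  intro x
  have ha : a ≠ 0 := by rintro rfl; exact h.ne (by simpa using e)
  rw [h'.rho_tt, e, refl_smul cs _ _ ha]

lemma tt_neg {β : B → ℝ} (h : IsRoot cs β) : tt cs (-β) = tt cs β :=
  tt_smul h.neg h (a := -1) (by simp)

lemma tt_mul_self {β : B → ℝ} (h : IsRoot cs β) : tt cs β * tt cs β = 1 :=
  h.tt_spec.1.mul_self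

lemma tt_inv {β : B → ℝ} (h : IsRoot cs β) : (tt cs β)⁻¹ = tt cs β :=
  h.tt_spec.1.inv

lemma exists_root {t : W} (ht : cs.IsReflection t) : ∃ β, IsRoot cs β ∧ Pos β ∧ tt cs β = t := by
  obtain ⟨w, i, rfl⟩ := ht
  have hr : IsRoot cs (rho cs w (sr i)) := ⟨w, i, rfl⟩
  have e := tt_eq hr (rho_conj cs w i)
  rcases hr.pos_or with h | h
  · exact ⟨_, hr, h, e⟩
  · exact ⟨_, hr.neg, h, by rw [tt_neg hr, e]⟩

lemma eq_smul_sr {β : B → ℝ} {i : B} (hp : Pos β)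
    (hn : Pos (-(rho cs (cs.simple i) β))) : β = (β i) • sr i := by
  classical
  funext b
  by_cases hb : b = i
  · subst hb; simp [sr]
  · have h1 := hn b
    have h2 := hp b
    rw [rho_simple] at h1
    simp [sr, hb] at h1 ⊢
    linarith

lemma exists_shorter {γ : B → ℝ} (hr : IsRoot cs γ) (hp : Pos γ) (ω : List B)
    (hn : Pos (-(rho cs (cs.wordProd ω) γ))) :
    ∃ ω' : List B, ω'.length < ω.length ∧ cs.wordProd ω * tt cs γ = cs.wordProd ω' := by
  induction ω with
  | nil =>
    simp at hn
    exact absurd (hp.eq_zero hn) hr.ne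
  | cons i ω ih =>
    rcases (hr.map (cs.wordProd ω)).pos_or with h | h
    · rw [cs.wordProd_cons, rho_mul] at hn
      have e := eq_smul_sr h hn
      have e2 := tt_smul (hr.map (cs.wordProd ω)) (isRoot_sr i) e
      rw [tt_map hr, tt_sr] at e2
      refine ⟨ω, by simp, ?_⟩
      rw [cs.wordProd_cons, ← e2]
      have := tt_mul_self hr
      calc _ = cs.wordProd ω * (tt cs γ * tt cs γ) := by group
        _ = _ := by rw [this, mul_one]
    · obtain ⟨ω', h1, h2⟩ := ih h
      exact ⟨i :: ω', by simpa using h1, by rw [cs.wordProd_cons, cs.wordProd_cons, mul_assoc, h2]⟩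

lemma length_lt_of_neg {γ : B → ℝ} (hr : IsRoot cs γ) (hp : Pos γ) (w : W)
    (hn : Pos (-(rho cs w γ))) : cs.length (w * tt cs γ) < cs.length w := by
  obtain ⟨ω, hω, rfl⟩ := cs.exists_isReduced w
  obtain ⟨ω', h1, h2⟩ := exists_shorter hr hp ω hn
  rw [h2, hω.eq]
  exact lt_of_le_of_lt (cs.length_wordProd_le ω') h1

lemma refl_self {β : B → ℝ} (h : β ≠ 0) : refl cs β β = -β := by
  have := F_pos cs h
  rw [refl, mul_div_assoc, div_self this.ne']; module

lemma neg_of_length_lt {γ : B → ℝ} (hr : IsRoot cs γ) (hp : Pos γ) (w : W)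
    (hn : cs.length (w * tt cs γ) < cs.length w) : Pos (-(rho cs w γ)) := by
  rcases (hr.map w).pos_or with h | h
  · exfalso
    have h2 : Pos (-(rho cs (w * tt cs γ) γ)) := by
      rw [rho_mul, hr.rho_tt, refl_self hr.ne]; simpa using h
    have := length_lt_of_neg hr hp _ h2
    rw [mul_assoc, tt_mul_self hr, mul_one] at this
    omega
  · exact h

end Form


section Lin

variable [Fintype B]

/-- linear combination -/
noncomputable def T (β : B → B → ℝ) : (B → ℝ) →ₗ[ℝ] (B → ℝ) := Fintype.linearCombination ℝ β

lemma T_apply (β : B → B → ℝ) (c : B → ℝ) : T β c = ∑ i, c i • β i := rfl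

lemma T_sr (β : B → B → ℝ) (i : B) : T β (sr i) = β i := by
  classical
  simp [T_apply, sr, Pi.single_apply]

lemma T_sr_id (c : B → ℝ) : T sr c = c := by
  classical
  funext b
  simp [T_apply, sr, Pi.single_apply]

/-- supported on a list -/
def Supp (l : List B) (c : B → ℝ) : Prop := ∀ i, i ∉ l → c i = 0

lemma Supp.mono {l l' : List B} (h : ∀ i ∈ l, i ∈ l') {c : B → ℝ} (hc : Supp l c) : Supp l' c :=
  fun i hi => hc i (fun h' => hi (h i h'))
lemma Supp.add {l : List B} {c d : B → ℝ} (hc : Supp l c) (hd : Supp l d) : Supp l (c + d) :=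
  fun i hi => by simp [hc i hi, hd i hi]
lemma Supp.sub {l : List B} {c d : B → ℝ} (hc : Supp l c) (hd : Supp l d) : Supp l (c - d) :=
  fun i hi => by simp [hc i hi, hd i hi]
lemma Supp.smul {l : List B} {c : B → ℝ} (a : ℝ) (hc : Supp l c) : Supp l (a • c) :=
  fun i hi => by simp [hc i hi]
lemma supp_zero (l : List B) : Supp l (0 : B → ℝ) := fun _ _ => rfl
lemma supp_sr {l : List B} {i : B} (hi : i ∈ l) : Supp l (sr i) := by
  classical
  intro j hj
  have : j ≠ i := by rintro rfl; exact hj hi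
  simp [sr, this]

lemma sr_self (i : B) : (sr i : B → ℝ) i = 1 := by simp [sr]
lemma sr_of_ne {i j : B} (h : j ≠ i) : (sr i : B → ℝ) j = 0 := by simp [sr, h]

/-- span of a list -/
def sp (p : List (B → ℝ)) : Submodule ℝ (B → ℝ) := Submodule.span ℝ {x | x ∈ p}

lemma mem_sp {p : List (B → ℝ)} {x : B → ℝ} (h : x ∈ p) : x ∈ sp p := Submodule.subset_span h

lemma sp_mono {p q : List (B → ℝ)} (h : ∀ x ∈ p, x ∈ q) : sp p ≤ sp q := Submodule.span_mono h

lemma sp_append (p q : List (B → ℝ)) : sp (p ++ q) = sp p ⊔ sp q := by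
  rw [sp, sp, sp, ← Submodule.span_union]
  congr 1
  ext x; simp

lemma finrank_sp_le (p : List (B → ℝ)) : Module.finrank ℝ (sp p) ≤ p.length := by
  classical
  have : {x | x ∈ p} = (p.toFinset : Set (B → ℝ)) := by ext; simp
  rw [sp, this]
  exact (finrank_span_finset_le_card _).trans (List.toFinset_card_le _)

lemma mem_sp_map {β : B → B → ℝ} {l : List B} {x : B → ℝ} :
    x ∈ sp (l.map β) ↔ ∃ c, Supp l c ∧ x = T β c := by
  constructor
  · intro h
    induction h using Submodule.span_induction with
    | mem x hx =>
      obtain ⟨i, hi, rfl⟩ := List.mem_map.mp hx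
      exact ⟨sr i, supp_sr hi, (T_sr β i).symm⟩
    | zero => exact ⟨0, supp_zero l, by simp⟩
    | add x y _ _ hx hy =>
      obtain ⟨c, hc, rfl⟩ := hx
      obtain ⟨d, hd, rfl⟩ := hy
      exact ⟨c + d, hc.add hd, by simp⟩
    | smul a x _ hx =>
      obtain ⟨c, hc, rfl⟩ := hx
      exact ⟨a • c, hc.smul a, by simp⟩
  · rintro ⟨c, hc, rfl⟩
    rw [T_apply]
    apply Submodule.sum_mem
    intro i _
    by_cases hi : i ∈ l
    · exact Submodule.smul_mem _ _ (mem_sp (List.mem_map_of_mem hi))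
    · rw [hc i hi]; simp

/-- independence -/
def Ind (β : B → B → ℝ) (l : List B) : Prop := ∀ c, Supp l c → T β c = 0 → c = 0

lemma Ind.eq {β : B → B → ℝ} {l : List B} (h : Ind β l) {c d : B → ℝ} (hc : Supp l c)
    (hd : Supp l d) (e : T β c = T β d) : c = d :=
  sub_eq_zero.mp (h _ (hc.sub hd) (by rw [map_sub, e, sub_self]))

lemma Ind.mono {β : B → B → ℝ} {l l' : List B} (h : Ind β l) (hl : ∀ i ∈ l', i ∈ l) : Ind β l' :=
  fun c hc e => h c (hc.mono hl) e

lemma Ind.finrank {β : B → B → ℝ} {l : List B} (h : Ind β l) (hn : l.Nodup) :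
    Module.finrank ℝ (sp (l.map β)) = l.length := by
  classical
  have hset : {x | x ∈ l.map β} = Set.range (fun i : {i // i ∈ l.toFinset} => β i) := by
    ext x; simp
  have hli : LinearIndependent ℝ (fun i : {i // i ∈ l.toFinset} => β i) := by
    rw [Fintype.linearIndependent_iff]
    intro g hg i
    let c : B → ℝ := fun b => if hb : b ∈ l.toFinset then g ⟨b, hb⟩ else 0
    have hc : Supp l c := by
      intro b hb
      have : b ∉ l.toFinset := by simpa using hb
      simp only [c, dif_neg this]
    have e : T β c = 0 := by
      rw [T_apply, ← hg, ← Finset.sum_subset (Finset.subset_univ l.toFinset)]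
      · rw [← Finset.sum_coe_sort]
        apply Finset.sum_congr rfl
        intro b _
        simp only [c, dif_pos b.2]
      · intro b _ hb
        simp only [c, dif_neg hb, zero_smul]
    have := congrFun (h c hc e) i
    simp only [c, dif_pos i.2] at this
    exact this
  rw [sp, hset, finrank_span_eq_card hli, Fintype.card_coe, List.toFinset_card_of_nodup hn]

variable [Finite W] {cs : CoxeterSystem M W}

variable (cs) in
/-- product of reflections -/
noncomputable def pr (p : List (B → ℝ)) : W := (p.map (tt cs)).prod

lemma pr_nil : pr cs [] = 1 := rfl
lemma pr_cons (β : B → ℝ) (p) : pr cs (β :: p) = tt cs β * pr cs p := by simp [pr]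
lemma pr_append (p q) : pr cs (p ++ q) = pr cs p * pr cs q := by simp [pr]

lemma pr_map (p : List (B → ℝ)) (hp : ∀ x ∈ p, IsRoot cs x) (w : W) :
    pr cs (p.map (rho cs w)) = w * pr cs p * w⁻¹ := by
  induction p with
  | nil => simp [pr_nil]
  | cons β p ih =>
    rw [List.map_cons, pr_cons, pr_cons, ih (fun x hx => hp x (by simp [hx])),
      tt_map (hp β (by simp))]
    group

variable (cs) in
/-- moved space -/
noncomputable def mov (w : W) : Submodule ℝ (B → ℝ) :=
  LinearMap.range ((rho cs w : (B → ℝ) →ₗ[ℝ] (B → ℝ)) - LinearMap.id)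

lemma mem_mov {w : W} {x : B → ℝ} : x ∈ mov cs w ↔ ∃ y, rho cs w y - y = x := by
  simp [mov]

lemma sub_mem_mov (w : W) (y : B → ℝ) : rho cs w y - y ∈ mov cs w := mem_mov.mpr ⟨y, rfl⟩

lemma refl_sub (β x : B → ℝ) : refl cs β x - x = (-(2 * F cs x β / F cs β β)) • β := by
  rw [refl]; module

lemma mov_le_sp {p : List (B → ℝ)} (hp : ∀ x ∈ p, IsRoot cs x) : mov cs (pr cs p) ≤ sp p := by
  intro x hx
  obtain ⟨y, rfl⟩ := mem_mov.mp hx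
  clear hx
  induction p with
  | nil => simp [pr_nil]
  | cons β p ih =>
    have h1 := ih (fun x hx => hp x (by simp [hx]))
    rw [pr_cons, rho_mul, (hp β (by simp)).rho_tt]
    have : refl cs β (rho cs (pr cs p) y) - y =
      (refl cs β (rho cs (pr cs p) y) - rho cs (pr cs p) y) + (rho cs (pr cs p) y - y) := by abel
    rw [this, refl_sub]
    refine Submodule.add_mem _ (Submodule.smul_mem _ _ (mem_sp (by simp))) ?_
    exact sp_mono (fun x hx => by simp [hx]) h1

lemma fix_orth {β : B → B → ℝ} {l : List B} (hn : l.Nodup) (hi : Ind β l)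
    (hr : ∀ i ∈ l, IsRoot cs (β i)) {x : B → ℝ} (hx : rho cs (pr cs (l.map β)) x = x) :
    ∀ i ∈ l, F cs x (β i) = 0 := by
  induction l with
  | nil => simp
  | cons i l ih =>
    have hri := hr i (by simp)
    rw [List.nodup_cons] at hn
    rw [List.map_cons, pr_cons, rho_mul, hri.rho_tt] at hx
    set y := rho cs (pr cs (l.map β)) x with hy
    have h1 : y - x ∈ sp (l.map β) := by
      apply mov_le_sp (cs := cs)
      · intro z hz
        obtain ⟨j, hj, rfl⟩ := List.mem_map.mp hz
        exact hr j (by simp [hj])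
      · exact sub_mem_mov _ x
    have h2 := refl_sub (cs := cs) (β i) y
    rw [hx] at h2
    obtain ⟨d, hd, hd'⟩ := mem_sp_map.mp h1
    set a := 2 * F cs y (β i) / F cs (β i) (β i) with ha
    have h3 : a • sr i = d := by
      apply hi.eq ((supp_sr (by simp)).smul a) (hd.mono (by simp +contextual))
      rw [map_smul, T_sr, ← hd', ← neg_sub x y, h2]; module
    have h4 : a = 0 := by
      have := congrFun h3 i
      rw [hd i hn.1] at this
      simpa [sr_self] using this
    have h5 : x = y := by
      rw [h4] at h2
      exact sub_eq_zero.mp (by simpa using h2)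
    have h6 : F cs x (β i) = 0 := by
      rw [ha, div_eq_zero_iff] at h4
      have := F_pos cs hri.ne
      rcases h4 with h4 | h4
      · rw [h5]; linarith
      · exact absurd h4 this.ne'
    intro j hj
    rcases List.mem_cons.mp hj with rfl | hj
    · exact h6
    · exact ih hn.2 (hi.mono (by simp +contextual)) (fun i hi => hr i (by simp [hi])) h5.symm j hj

lemma finrank_mov {β : B → B → ℝ} {l : List B} (hn : l.Nodup) (hi : Ind β l)
    (hr : ∀ i ∈ l, IsRoot cs (β i)) :
    Module.finrank ℝ (mov cs (pr cs (l.map β))) = l.length ∧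
      mov cs (pr cs (l.map β)) = sp (l.map β) := by
  have hr' : ∀ z ∈ l.map β, IsRoot cs z := by
    intro z hz
    obtain ⟨j, hj, rfl⟩ := List.mem_map.mp hz
    exact hr j hj
  have hle := mov_le_sp hr'
  have hfs := hi.finrank hn
  set w := pr cs (l.map β) with hw
  set f := ((rho cs w : (B → ℝ) →ₗ[ℝ] (B → ℝ)) - LinearMap.id) with hf
  have hdisj : Disjoint (LinearMap.ker f) (sp (l.map β)) := by
    rw [Submodule.disjoint_def]
    intro x hx hxs
    have hx' : rho cs w x = x := by
      have : rho cs w x - x = 0 := by simpa [hf] using hx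
      exact sub_eq_zero.mp this
    have ho := fix_orth hn hi hr hx'
    obtain ⟨c, hc, hxc⟩ := mem_sp_map.mp hxs
    apply F_eq_zero cs
    nth_rw 2 [hxc]
    rw [T_apply, map_sum]
    apply Finset.sum_eq_zero
    intro i _
    by_cases h : i ∈ l
    · rw [map_smul, ho i h, smul_zero]
    · rw [hc i h]; simp
  have h1 := Submodule.finrank_add_finrank_le_of_disjoint hdisj
  have h2 := LinearMap.finrank_range_add_finrank_ker f
  have h3 : mov cs w = LinearMap.range f := rfl
  have h4 := Submodule.finrank_mono hle
  rw [hfs] at h1 h4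
  rw [h3] at *
  have h5 : Module.finrank ℝ (LinearMap.range f) = l.length := by omega
  exact ⟨h5, Submodule.eq_of_le_of_finrank_eq hle (by rw [h5, hfs])⟩

/-- a shortest factorisation has independent roots -/
lemma factor_split {p q : List (B → ℝ)} (hp : ∀ x ∈ p, IsRoot cs x) (hq : ∀ x ∈ q, IsRoot cs x)
    (h : p.length + q.length ≤ Module.finrank ℝ (mov cs (pr cs (p ++ q)))) :
    Disjoint (sp p) (sp q) ∧ mov cs (pr cs (p ++ q)) = sp (p ++ q) := by
  have hpq : ∀ x ∈ p ++ q, IsRoot cs x := by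
    intro x hx
    rcases List.mem_append.mp hx with h | h
    · exact hp x h
    · exact hq x h
  have hle := mov_le_sp hpq
  have h1 := Submodule.finrank_mono hle
  have h2 := Submodule.finrank_sup_add_finrank_inf_eq (sp p) (sp q)
  rw [← sp_append] at h2
  have h3 := finrank_sp_le p
  have h4 := finrank_sp_le q
  constructor
  · rw [disjoint_iff, ← Submodule.finrank_eq_zero (R := ℝ)]
    omega
  · exact Submodule.eq_of_le_of_finrank_eq hle (by omega)

/-! absolute length -/

variable (cs) in
lemma exists_factor (w : W) : ∃ p : List (B → ℝ), (∀ x ∈ p, IsRoot cs x) ∧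
    p.length = absLength cs w ∧ pr cs p = w := by
  have hne : {k | ∃ l : List W, (∀ t ∈ l, cs.IsReflection t) ∧ l.length = k ∧ l.prod = w}.Nonempty := by
    obtain ⟨ω, rfl⟩ := cs.wordProd_surjective w
    refine ⟨_, ω.map cs.simple, ?_, rfl, rfl⟩
    intro t ht
    obtain ⟨i, _, rfl⟩ := List.mem_map.mp ht
    exact cs.isReflection_simple i
  obtain ⟨l, hl, hlen, hprod⟩ := Nat.sInf_mem hne
  rw [absLength, ← hlen, ← hprod]
  clear hlen hprod hne
  induction l with
  | nil => exact ⟨[], by simp, rfl, by simp [pr_nil]⟩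
  | cons t l ih =>
    obtain ⟨p, h1, h2, h3⟩ := ih (fun t ht => hl t (by simp [ht]))
    obtain ⟨β, hβ, -, ht⟩ := exists_root (hl t (by simp))
    refine ⟨β :: p, ?_, by simp [h2], by rw [pr_cons, h3, ht, List.prod_cons]⟩
    simpa using ⟨hβ, h1⟩

lemma absLength_le {p : List (B → ℝ)} (hp : ∀ x ∈ p, IsRoot cs x) :
    absLength cs (pr cs p) ≤ p.length := by
  apply Nat.sInf_le
  refine ⟨p.map (tt cs), ?_, by simp, rfl⟩
  intro t ht
  obtain ⟨x, hx, rfl⟩ := List.mem_map.mp ht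
  exact (hp x hx).tt_spec.1

lemma finrank_le_absLength (w : W) : Module.finrank ℝ (mov cs w) ≤ absLength cs w := by
  obtain ⟨p, h1, h2, h3⟩ := exists_factor cs w
  rw [← h2, ← h3]
  exact (Submodule.finrank_mono (mov_le_sp h1)).trans (finrank_sp_le p)

lemma absLength_ind {β : B → B → ℝ} {l : List B} (hn : l.Nodup) (hi : Ind β l)
    (hr : ∀ i ∈ l, IsRoot cs (β i)) : absLength cs (pr cs (l.map β)) = l.length := by
  apply le_antisymm
  · have : ∀ z ∈ l.map β, IsRoot cs z := by
      intro z hz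
      obtain ⟨j, hj, rfl⟩ := List.mem_map.mp hz
      exact hr j hj
    simpa using absLength_le this
  · rw [← (finrank_mov hn hi hr).1]
    exact finrank_le_absLength _

end Lin


section GoodSec

variable [Fintype B] [Finite W] {cs : CoxeterSystem M W}

variable (cs) in
/-- The family `β i`, `i ∈ l`, is the simple system of the roots in its span. -/
structure Good (β : B → B → ℝ) (l : List B) : Prop where
  nodup : l.Nodup
  root : ∀ i ∈ l, IsRoot cs (β i)
  pos : ∀ i ∈ l, Pos (β i)
  ind : Ind β l
  obt : ∀ i ∈ l, ∀ j ∈ l, i ≠ j → F cs (β i) (β j) ≤ 0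
  hull : ∀ γ, IsRoot cs γ → γ ∈ sp (l.map β) →
    (∃ c, Pos c ∧ Supp l c ∧ γ = T β c) ∨ (∃ c, Pos c ∧ Supp l c ∧ -γ = T β c)

lemma Good.root' {β : B → B → ℝ} {l : List B} (h : Good cs β l) : ∀ x ∈ l.map β, IsRoot cs x := by
  intro z hz
  obtain ⟨j, hj, rfl⟩ := List.mem_map.mp hz
  exact h.root j hj

lemma Good.mono {β : B → B → ℝ} {l l' : List B} (h : Good cs β l) (hn : l'.Nodup)
    (hl : ∀ i ∈ l', i ∈ l) : Good cs β l' where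
  nodup := hn
  root i hi := h.root i (hl i hi)
  pos i hi := h.pos i (hl i hi)
  ind := h.ind.mono hl
  obt i hi j hj := h.obt i (hl i hi) j (hl j hj)
  hull γ hγ hs := by
    obtain ⟨d, hd, hdγ⟩ := mem_sp_map.mp hs
    have hs' : γ ∈ sp (l.map β) := mem_sp_map.mpr ⟨d, hd.mono hl, hdγ⟩
    rcases h.hull γ hγ hs' with ⟨c, hc, hcs, e⟩ | ⟨c, hc, hcs, e⟩
    · left
      have : c = d := h.ind.eq hcs (hd.mono hl) (by rw [← e, hdγ])
      exact ⟨c, hc, this ▸ hd, e⟩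
    · right
      have : c = (-1 : ℝ) • d := h.ind.eq hcs ((hd.smul (-1)).mono hl) (by
        rw [← e, hdγ, map_smul]; module)
      exact ⟨c, hc, this ▸ hd.smul (-1), e⟩

lemma T_rho (β : B → B → ℝ) (w : W) (c : B → ℝ) :
    T (fun j => rho cs w (β j)) c = rho cs w (T β c) := by
  simp [T_apply]

lemma Good.map {β : B → B → ℝ} {l : List B} (h : Good cs β l) (w : W)
    (hp : ∀ i ∈ l, Pos (rho cs w (β i))) : Good cs (fun j => rho cs w (β j)) l where
  nodup := h.nodup
  root i hi := (h.root i hi).map w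
  pos := hp
  ind c hc e := by
    rw [T_rho] at e
    exact h.ind c hc (by simpa using e)
  obt i hi j hj hij := by rw [F_inv]; exact h.obt i hi j hj hij
  hull γ hγ hs := by
    obtain ⟨d, hd, hdγ⟩ := mem_sp_map.mp hs
    rw [T_rho] at hdγ
    have e1 : rho cs w⁻¹ γ = T β d := by rw [hdγ, rho_self_inv]
    rcases h.hull _ (hγ.map w⁻¹) (mem_sp_map.mpr ⟨d, hd, e1⟩) with ⟨c, hc, hcs, e⟩ | ⟨c, hc, hcs, e⟩
    · exact Or.inl ⟨c, hc, hcs, by rw [T_rho, ← e, rho_inv_self]⟩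
    · exact Or.inr ⟨c, hc, hcs, by rw [T_rho, ← e, map_neg, rho_inv_self]⟩

lemma F_sr_le (i j : B) (hij : i ≠ j) : F cs (sr i) (sr j) ≤ 0 := by
  -- from positivity of the reflected root
  have h0 := F_pos cs (sr_ne (B := B) j)
  have h1 : Pos (rho cs (cs.simple j) (sr i)) := by
    rcases ((isRoot_sr (cs := cs) i).map (cs.simple j)).pos_or with h | h
    · exact h
    · exfalso
      have := congrFun (eq_smul_sr (pos_sr i) h) i
      rw [sr_self, sr_of_ne hij.symm] at this
      simp at this
  rw [rho_simple_refl, refl] at h1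
  have h2 := h1 j
  simp only [Pi.sub_apply, Pi.smul_apply, smul_eq_mul, sr_self, sr_of_ne hij.symm] at h2
  rw [mul_one, zero_sub, neg_nonneg] at h2
  rcases div_nonpos_iff.mp h2 with h3 | h3
  · linarith
  · linarith

lemma good_sr {l : List B} (hn : l.Nodup) : Good cs sr l where
  nodup := hn
  root i _ := isRoot_sr i
  pos i _ := pos_sr i
  ind c _ e := by rwa [T_sr_id] at e
  obt i _ j _ h := F_sr_le i j h
  hull γ hγ hs := by
    obtain ⟨d, hd, e⟩ := mem_sp_map.mp hs
    rw [T_sr_id] at e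
    subst e
    rcases hγ.pos_or with h | h
    · exact Or.inl ⟨_, h, hd, (T_sr_id _).symm⟩
    · refine Or.inr ⟨_, h, ?_, (T_sr_id _).symm⟩
      intro i hi; simp [hd i hi]

lemma wordProd_eq (l : List B) : cs.wordProd l = pr cs (l.map sr) := by
  simp only [wordProd, pr, List.map_map]
  congr 1
  apply List.map_congr_left
  intro i _
  exact (tt_sr (cs := cs) i).symm

variable (cs) in
/-- `w` is the ordered product of `n` roots of a simple system. -/
def GoodW (w : W) (n : ℕ) : Prop :=
  ∃ β l, Good cs β l ∧ l.length = n ∧ pr cs (l.map β) = w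

lemma exists_coweight (i : B) : ∃ ω : B → ℝ, ∀ x, F cs ω x = x i := by
  have hinj : Function.Injective (F cs) := by
    rw [← LinearMap.ker_eq_bot, LinearMap.ker_eq_bot']
    intro x hx
    apply F_eq_zero cs
    rw [hx]; rfl
  have hsurj : Function.Surjective (F cs) :=
    (LinearMap.injective_iff_surjective_of_finrank_eq_finrank
      (Subspace.dual_finrank_eq (K := ℝ) (V := B → ℝ)).symm).mp hinj
  obtain ⟨ω, hω⟩ := hsurj (LinearMap.proj i)
  exact ⟨ω, fun x => by rw [hω]; rfl⟩

lemma F_T (β : B → B → ℝ) (c x : B → ℝ) : F cs (T β c) x = ∑ i, c i * F cs (β i) x := by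
  simp [T_apply, LinearMap.sum_apply]

lemma Pos.T {β : B → B → ℝ} {l : List B} (hβ : ∀ i ∈ l, Pos (β i)) {c : B → ℝ} (hc : Pos c)
    (hs : Supp l c) : Pos (T β c) := by
  intro b
  rw [T_apply, Finset.sum_apply]
  apply Finset.sum_nonneg
  intro i _
  by_cases hi : i ∈ l
  · exact mul_nonneg (hc i) (hβ i hi b)
  · rw [hs i hi]; simp

/-- the product pushes dominant vectors down -/
lemma Good.push {β : B → B → ℝ} {l : List B} (h : Good cs β l) {ω : B → ℝ}
    (hω : ∀ k ∈ l, 0 ≤ F cs ω (β k)) :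
    ∃ c, Pos c ∧ Supp l c ∧ rho cs (pr cs (l.map β)) ω = ω - T β c := by
  induction l with
  | nil => exact ⟨0, fun _ => le_rfl, supp_zero _, by simp [pr_nil]⟩
  | cons i l ih =>
    have hn := List.nodup_cons.mp h.nodup
    obtain ⟨c, hc, hs, e⟩ := ih (h.mono hn.2 (by simp +contextual)) (fun k hk => hω k (by simp [hk]))
    have hri := h.root i (by simp)
    have h0 := F_pos cs hri.ne
    set y := ω - T β c with hy
    set a := 2 * F cs y (β i) / F cs (β i) (β i) with ha
    have ha0 : 0 ≤ a := by
      apply div_nonneg _ h0.le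
      apply mul_nonneg zero_le_two
      rw [hy, map_sub, LinearMap.sub_apply, F_T]
      have h1 := hω i (by simp)
      have h2 : ∑ k, c k * F cs (β k) (β i) ≤ 0 := by
        apply Finset.sum_nonpos
        intro k _
        by_cases hk : k ∈ l
        · have hki : k ≠ i := by rintro rfl; exact hn.1 hk
          exact mul_nonpos_of_nonneg_of_nonpos (hc k) (h.obt k (by simp [hk]) i (by simp) hki)
        · rw [hs k hk]; simp
      linarith
    refine ⟨c + a • sr i, hc.add ((pos_sr i).smul ha0),
      (hs.mono (by simp +contextual)).add ((supp_sr (by simp)).smul a), ?_⟩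
    rw [List.map_cons, pr_cons, rho_mul, e, hri.rho_tt, refl, map_add, map_smul, T_sr]
    rw [hy]; module

lemma tt_comm {β γ : B → ℝ} (hβ : IsRoot cs β) (hγ : IsRoot cs γ) (h : F cs β γ = 0) :
    tt cs β * tt cs γ = tt cs γ * tt cs β := by
  have e : rho cs (tt cs γ) β = β := by
    rw [hγ.rho_tt, refl, h]; simp
  have := tt_map hβ (tt cs γ)
  rw [e, tt_inv hγ] at this
  calc _ = (tt cs γ * tt cs β * tt cs γ) * tt cs γ := by rw [← this]
    _ = _ := by rw [mul_assoc _ _ (tt cs γ), tt_mul_self hγ, mul_one]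

lemma pr_comm {p : List (B → ℝ)} (hp : ∀ x ∈ p, IsRoot cs x) {γ : B → ℝ} (hγ : IsRoot cs γ)
    (h : ∀ x ∈ p, F cs x γ = 0) : pr cs p * tt cs γ = tt cs γ * pr cs p := by
  induction p with
  | nil => simp [pr_nil]
  | cons β p ih =>
    rw [pr_cons, mul_assoc, ih (fun x hx => hp x (by simp [hx])) (fun x hx => h x (by simp [hx])),
      ← mul_assoc, tt_comm (hp β (by simp)) hγ (h β (by simp)), mul_assoc]

/-- conjugation by the initial letter of the Coxeter element -/
lemma conj_good {i : B} {l' : List B} (hn : (i :: l').Nodup) {p q : List (B → ℝ)}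
    (hp : ∀ x ∈ p, IsRoot cs x) (hq : ∀ x ∈ q, IsRoot cs x)
    (hpq : pr cs (p ++ q) = cs.wordProd (i :: l')) (hlen : p.length + q.length = l'.length + 1)
    (hg : GoodW cs (pr cs p) p.length) :
    GoodW cs (cs.simple i * pr cs p * cs.simple i) p.length := by
  obtain ⟨β, l, hG, hl, hw⟩ := hg
  by_cases hcase : ∀ j ∈ l, Pos (rho cs (cs.simple i) (β j))
  · refine ⟨_, l, hG.map _ hcase, hl, ?_⟩
    have := pr_map (l.map β) hG.root' (cs.simple i)
    rw [List.map_map, hw, cs.inv_simple] at this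
    exact this
  · push Not at hcase
    obtain ⟨j, hj, hneg⟩ := hcase
    have hrj := hG.root j hj
    have hneg' := (hrj.map (cs.simple i)).pos_or.resolve_left hneg
    have hβj := eq_smul_sr (hG.pos j hj) hneg'
    set κ := β j i with hκ
    have hκ0 : 0 ≤ κ := hG.pos j hj i
    have hκ1 : 0 < κ := by
      rcases hκ0.eq_or_lt with h | h
      · exfalso; rw [← h] at hβj; exact hrj.ne (by simpa using hβj)
      · exact h
    have htt : tt cs (β j) = cs.simple i := by rw [tt_smul hrj (isRoot_sr i) hβj, tt_sr]
    have hsr : sr i = κ⁻¹ • β j := by rw [hβj, smul_smul, inv_mul_cancel₀ hκ1.ne', one_smul]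
    -- coweight
    obtain ⟨ω, hω⟩ := exists_coweight (cs := cs) i
    obtain ⟨k0, hk0, hcω⟩ : ∃ k0 : ℝ, 0 < k0 ∧
        rho cs (cs.wordProd (i :: l')) ω = ω - k0 • sr i := by
      refine ⟨2 / F cs (sr i) (sr i), div_pos two_pos (F_pos cs (sr_ne i)), ?_⟩
      have h1 : ∀ m : List B, i ∉ m → rho cs (cs.wordProd m) ω = ω := by
        intro m
        induction m with
        | nil => simp
        | cons b m ih =>
          intro hb
          simp only [List.mem_cons, not_or] at hb
          rw [cs.wordProd_cons, rho_mul, ih hb.2, rho_simple_refl, refl, hω, sr_of_ne hb.1]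
          simp
      rw [cs.wordProd_cons, rho_mul, h1 l' (List.nodup_cons.mp hn).1, rho_simple_refl, refl, hω,
        sr_self, mul_one]
    set k := k0 * κ⁻¹ with hk
    have hkpos : 0 < k := mul_pos hk0 (inv_pos.mpr hκ1)
    rw [hsr, smul_smul, ← hk, ← hpq, pr_append, rho_mul] at hcω
    -- split
    have hfr : p.length + q.length ≤ Module.finrank ℝ (mov cs (pr cs (p ++ q))) := by
      rw [hpq, wordProd_eq, (finrank_mov hn (good_sr (cs := cs) hn).ind (fun i _ => isRoot_sr i)).1, hlen]
      simp
    have hdisj := (factor_split hp hq hfr).1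
    have hmovp : mov cs (pr cs p) = sp (l.map β) := by
      rw [← hw]; exact (finrank_mov hG.nodup hG.ind hG.root).2
    have hβp : sp (l.map β) ≤ sp p := by rw [← hmovp]; exact mov_le_sp hp
    have hx : rho cs (pr cs q) ω = ω := by
      have h1 : rho cs (pr cs q) ω - ω ∈ sp q := mov_le_sp hq (sub_mem_mov _ _)
      have h2 : rho cs (pr cs q) ω - ω ∈ sp p := by
        set z := rho cs (pr cs q) ω
        have e : z - ω = -(rho cs (pr cs p) z - z) - k • β j := by rw [hcω]; abel
        rw [e]
        apply Submodule.sub_mem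
        · exact Submodule.neg_mem _ (mov_le_sp hp (sub_mem_mov _ _))
        · exact Submodule.smul_mem _ _ (hβp (mem_sp (List.mem_map_of_mem hj)))
      exact sub_eq_zero.mp ((Submodule.disjoint_def.mp hdisj) _ h2 h1)
    rw [hx, ← hw] at hcω
    -- decompose l
    obtain ⟨A, C, rfl⟩ := List.append_of_mem hj
    have hnd := hG.nodup
    have hnA : A.Nodup := (List.nodup_append.mp hnd).1
    have hnC : (j :: C).Nodup := (List.nodup_append.mp hnd).2.1
    have hAC : ∀ a ∈ A, a ∉ j :: C := fun a ha hc => (List.nodup_append.mp hnd).2.2 a ha a hc rfl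
    have hGA := hG.mono hnA (by simp +contextual)
    have hGC := hG.mono hnC (by intro x hx; simp only [List.mem_append]; exact Or.inr hx)
    have hdom : ∀ m ∈ A ++ j :: C, 0 ≤ F cs ω (β m) := by
      intro m hm; rw [hω]; exact hG.pos m hm i
    obtain ⟨c, hc, hcs, ec⟩ := hGC.push (fun m hm => hdom m (by
      simp only [List.mem_append]; exact Or.inr hm))
    rw [List.map_append, pr_append, rho_mul, ec] at hcω
    -- c = k • sr j
    have hin : T β c - k • β j ∈ sp (A.map β) := by
      have h1 := mov_le_sp hGA.root' (sub_mem_mov (cs := cs) (pr cs (A.map β)) (ω - T β c))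
      rw [hcω] at h1
      have : ω - k • β j - (ω - T β c) = T β c - k • β j := by abel
      rwa [this] at h1
    obtain ⟨d, hd, ed⟩ := mem_sp_map.mp hin
    have e3 : c - k • sr j = d := by
      apply hG.ind.eq _ (hd.mono (by simp +contextual)) _
      · apply Supp.sub
        · exact hcs.mono (by intro x hx; simp only [List.mem_append]; exact Or.inr hx)
        · exact (supp_sr (by simp)).smul k
      · rw [map_sub, map_smul, T_sr, ed]
    have e4 : c - k • sr j = 0 := by
      funext b
      by_cases hb : b ∈ A
      · have hbj : b ≠ j := by rintro rfl; exact hAC b hb (by simp)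
        simp [hcs b (hAC b hb), sr_of_ne hbj]
      · rw [e3, hd b hb]; rfl
    have e5 : T β c = k • β j := by rw [sub_eq_zero.mp e4, map_smul, T_sr]
    rw [e5] at hcω
    have horth := fix_orth hnA hGA.ind hGA.root hcω
    have horth' : ∀ x ∈ A.map β, F cs x (β j) = 0 := by
      intro x hx
      obtain ⟨a, ha, rfl⟩ := List.mem_map.mp hx
      have h1 := horth a ha
      rw [map_sub, map_smul, LinearMap.sub_apply, LinearMap.smul_apply, smul_eq_mul] at h1
      have h2 := hdom a (by simp [ha])
      have haj : a ≠ j := by rintro rfl; exact hAC a ha (by simp)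
      have h3 := hG.obt a (by simp [ha]) j (by simp) haj
      rw [F_symm cs (β j)] at h1
      have h4 : k * F cs (β a) (β j) ≤ 0 := mul_nonpos_of_nonneg_of_nonpos hkpos.le h3
      have h5 : k * F cs (β a) (β j) = 0 := by linarith
      exact (mul_eq_zero.mp h5).resolve_left hkpos.ne'
    have hcomm := pr_comm hGA.root' hrj horth'
    refine ⟨β, A ++ C ++ [j], hG.mono ?_ ?_, ?_, ?_⟩
    · have : (A ++ j :: C).Perm (A ++ C ++ [j]) := by
        rw [List.append_assoc]
        exact List.Perm.append_left A (List.perm_append_singleton j C).symm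
      exact this.nodup_iff.mp hnd
    · intro x; simp; tauto
    · rw [← hl]; simp
    · rw [← hw]
      simp only [List.map_append, List.map_cons, List.map_nil, pr_append, pr_cons, pr_nil, mul_one]
      rw [← htt]
      have h2 := tt_mul_self hrj
      calc _ = (tt cs (β j) * tt cs (β j)) * (pr cs (A.map β) * pr cs (C.map β) * tt cs (β j)) := by
            rw [h2, one_mul]
        _ = tt cs (β j) * ((tt cs (β j) * pr cs (A.map β)) * pr cs (C.map β)) * tt cs (β j) := by
            simp only [mul_assoc]
        _ = _ := by rw [← hcomm]; simp only [mul_assoc]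

end GoodSec


section MainSec

variable [Fintype B] [Finite W] {cs : CoxeterSystem M W}

variable (cs) in
/-- a putative counterexample -/
structure Bad (l : List B) (p q : List (B → ℝ)) (γ : B → ℝ) : Prop where
  nodup : l.Nodup
  len : p.length + q.length + 1 = l.length
  hp : ∀ x ∈ p, IsRoot cs x
  hq : ∀ x ∈ q, IsRoot cs x
  hγ : IsRoot cs γ
  pos : Pos γ
  prod : pr cs (p ++ (q ++ [γ])) = cs.wordProd l
  bad : ¬ GoodW cs (pr cs p) p.length

variable (cs) in
/-- the inductive statement -/
def MainAt (n : ℕ) : Prop :=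
  ∀ (l : List B) (p q : List (B → ℝ)), l.length = n → l.Nodup →
    (∀ x ∈ p, IsRoot cs x) → (∀ x ∈ q, IsRoot cs x) → pr cs (p ++ q) = cs.wordProd l →
    p.length + q.length = l.length → GoodW cs (pr cs p) p.length

lemma map_root {p : List (B → ℝ)} (hp : ∀ x ∈ p, IsRoot cs x) (w : W) :
    ∀ x ∈ p.map (rho cs w), IsRoot cs x := by
  intro x hx
  obtain ⟨y, hy, rfl⟩ := List.mem_map.mp hx
  exact (hp y hy).map w

lemma Bad.step {l' : List B} {i : B} {p q : List (B → ℝ)} {γ : B → ℝ}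
    (h : Bad cs (l' ++ [i]) p q γ) (ih : MainAt cs l'.length) :
    Bad cs (i :: l') (p.map (rho cs (cs.simple i))) (q.map (rho cs (cs.simple i)))
      (rho cs (cs.simple i) γ) := by
  have hperm : (l' ++ [i]).Perm (i :: l') := List.perm_append_singleton i l'
  have hnd : (i :: l').Nodup := hperm.nodup_iff.mp h.nodup
  have hall : ∀ x ∈ p ++ (q ++ [γ]), IsRoot cs x := by
    intro x hx
    simp only [List.mem_append, List.mem_singleton] at hx
    rcases hx with hx | hx | rfl
    · exact h.hp x hx
    · exact h.hq x hx
    · exact h.hγ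
  have hlen := h.len
  have hprod : pr cs (p.map (rho cs (cs.simple i)) ++ (q.map (rho cs (cs.simple i)) ++
      [rho cs (cs.simple i) γ])) = cs.wordProd (i :: l') := by
    have := pr_map (p ++ (q ++ [γ])) hall (cs.simple i)
    rw [h.prod, cs.wordProd_append, cs.wordProd_singleton] at this
    rw [cs.wordProd_cons]
    simp only [List.map_append, List.map_cons, List.map_nil] at this
    rw [this]
    group
  have hbad : ¬ GoodW cs (pr cs (p.map (rho cs (cs.simple i)))) (p.map (rho cs (cs.simple i))).length := by
    intro hg
    apply h.bad
    have hq' : ∀ x ∈ q.map (rho cs (cs.simple i)) ++ [rho cs (cs.simple i) γ], IsRoot cs x := by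
      intro x hx
      rcases List.mem_append.mp hx with hx | hx
      · exact map_root h.hq _ x hx
      · rw [List.mem_singleton.mp hx]; exact h.hγ.map _
    have := conj_good hnd (map_root h.hp _) hq' hprod (by simp at hlen ⊢; omega) hg
    rw [pr_map p h.hp] at this
    have e : cs.simple i * (cs.simple i * pr cs p * (cs.simple i)⁻¹) * cs.simple i = pr cs p := by
      rw [cs.inv_simple]
      simp [mul_assoc]
    rw [e] at this
    simpa using this
  refine ⟨hnd, by simp at hlen ⊢; omega, map_root h.hp _, map_root h.hq _, h.hγ.map _, ?_, hprod, hbad⟩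
  rcases (h.hγ.map (cs.simple i)).pos_or with h1 | h1
  · exact h1
  · exfalso
    have e := eq_smul_sr h.pos h1
    have ht : tt cs γ = cs.simple i := by rw [tt_smul h.hγ (isRoot_sr i) e, tt_sr]
    apply h.bad
    refine ih l' p q rfl (List.nodup_cons.mp hnd).2 h.hp h.hq ?_ (by simp at hlen; omega)
    have h2 := h.prod
    rw [← List.append_assoc, pr_append, pr_cons, pr_nil, mul_one, ht, cs.wordProd_append,
      cs.wordProd_singleton] at h2
    exact mul_right_cancel h2

lemma Bad.rot {n : ℕ} (ih : ∀ m < n, MainAt cs m) (l2 : List B) : ∀ (l1 : List B)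
    {p q : List (B → ℝ)} {γ : B → ℝ}, (l1 ++ l2).length = n → Bad cs (l1 ++ l2) p q γ →
    ∃ p' q', Bad cs (l2 ++ l1) p' q' (rho cs (cs.wordProd l2) γ) := by
  induction l2 using List.reverseRecOn with
  | nil =>
    intro l1 p q γ _ h
    exact ⟨p, q, by simpa using h⟩
  | append_singleton l2 i IH =>
    intro l1 p q γ hn h
    rw [← List.append_assoc] at h
    have h1 := h.step (ih _ (by simp at hn ⊢; omega))
    obtain ⟨p', q', h2⟩ := IH (i :: l1) (by simp at hn ⊢; omega) h1
    refine ⟨p', q', ?_⟩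
    rw [cs.wordProd_append, cs.wordProd_singleton, rho_mul]
    simpa using h2

lemma Bad.pow {l : List B} (ih : ∀ m < l.length, MainAt cs m) {p q : List (B → ℝ)} {γ : B → ℝ}
    (h : Bad cs l p q γ) (k : ℕ) :
    ∃ p' q', Bad cs l p' q' (rho cs (cs.wordProd l ^ k) γ) := by
  induction k with
  | zero => exact ⟨p, q, by simpa using h⟩
  | succ k IH =>
    obtain ⟨p', q', h'⟩ := IH
    obtain ⟨p2, q2, h2⟩ := Bad.rot (n := l.length) ih l [] (by simp) h'
    refine ⟨p2, q2, ?_⟩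
    rw [pow_succ', rho_mul]
    simpa using h2

lemma rank_word {l : List B} (hn : l.Nodup) :
    Module.finrank ℝ (mov cs (cs.wordProd l)) = l.length := by
  rw [wordProd_eq, (finrank_mov hn (good_sr (cs := cs) hn).ind (fun i _ => isRoot_sr i)).1]

lemma Bad.false {l : List B} (ih : ∀ m < l.length, MainAt cs m) {p q : List (B → ℝ)} {γ : B → ℝ}
    (h : Bad cs l p q γ) : False := by
  set c := cs.wordProd l with hc
  have hγ : γ ∈ mov cs c := by
    have hq' : ∀ x ∈ q ++ [γ], IsRoot cs x := by
      intro x hx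
      rcases List.mem_append.mp hx with hx | hx
      · exact h.hq x hx
      · rw [List.mem_singleton.mp hx]; exact h.hγ
    have h1 := factor_split h.hp hq' (by
      rw [h.prod, rank_word h.nodup, ← h.len]; simp; omega)
    rw [h.prod, ← hc] at h1
    rw [h1.2]
    exact mem_sp (by simp)
  obtain ⟨y, hy⟩ := mem_mov.mp hγ
  have hsum : ∑ k ∈ Finset.range (orderOf c), rho cs (c ^ k) γ = 0 := by
    have : ∀ k, rho cs (c ^ k) γ = rho cs (c ^ (k+1)) y - rho cs (c ^ k) y := by
      intro k
      rw [← hy, map_sub, pow_succ, rho_mul]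
    simp_rw [this]
    rw [Finset.sum_range_sub (fun k => rho cs (c ^ k) y), pow_orderOf_eq_one]
    simp
  have hpos : ∀ k, Pos (rho cs (c ^ k) γ) := fun k => by
    obtain ⟨_, _, h'⟩ := h.pow ih k
    exact h'.pos
  apply h.hγ.ne
  funext b
  have h0 : ∑ k ∈ Finset.range (orderOf c), rho cs (c ^ k) γ b = 0 := by
    have := congrFun hsum b
    simpa using this
  have h1 := (Finset.sum_eq_zero_iff_of_nonneg (fun k _ => hpos k b)).mp h0 0
    (Finset.mem_range.mpr (orderOf_pos c))
  simpa using h1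

theorem main_all (n : ℕ) : MainAt cs n := by
  induction n using Nat.strong_induction_on with
  | _ n ih =>
    intro l p q hl hn hp hq hpq hlen
    subst hl
    rcases List.eq_nil_or_concat q with rfl | ⟨q', γ, rfl⟩
    · rw [List.append_nil] at hpq
      refine ⟨sr, l, good_sr hn, by simpa using hlen.symm, ?_⟩
      rw [hpq, wordProd_eq]
    · rw [List.concat_eq_append] at *
      by_contra hbad
      have hγ : IsRoot cs γ := hq γ (by simp)
      rcases hγ.pos_or with h | h
      · exact Bad.false (γ := γ) ih ⟨hn, by simpa [add_assoc] using hlen, hp,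
          fun x hx => hq x (by simp [hx]), hγ, h, hpq, hbad⟩
      · refine Bad.false (γ := -γ) ih ⟨hn, by simpa [add_assoc] using hlen, hp,
          fun x hx => hq x (by simp [hx]), hγ.neg, h, ?_, hbad⟩
        rw [← hpq]
        simp only [pr_append, pr_cons, tt_neg hγ]

theorem absLength_cox {c : W} (hc : IsStdCoxeterElement cs c) : absLength cs c = Fintype.card B := by
  classical
  obtain ⟨l, hn, hl, rfl⟩ := hc
  rw [wordProd_eq, absLength_ind hn (good_sr (cs := cs) hn).ind (fun i _ => isRoot_sr i)]
  rw [← List.toFinset_card_of_nodup hn]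
  have : l.toFinset = Finset.univ := by ext; simp [hl]
  rw [this]; rfl

theorem nc_good {c w : W} (hc : IsStdCoxeterElement cs c) (hw : AbsLe cs w c) :
    GoodW cs w (absLength cs w) := by
  obtain ⟨p, hp, lp, ep⟩ := exists_factor cs w
  obtain ⟨q, hq, lq, eq⟩ := exists_factor cs (w⁻¹ * c)
  have h0 := absLength_cox hc
  obtain ⟨l, hn, hl, rfl⟩ := hc
  have hlen : absLength cs (cs.wordProd l) = l.length := by
    rw [wordProd_eq, absLength_ind hn (good_sr (cs := cs) hn).ind (fun i _ => isRoot_sr i)]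
  have := main_all (cs := cs) l.length l p q rfl hn hp hq (by rw [pr_append, ep, eq]; group)
    (by rw [lp, lq, ← hlen, hw]; omega)
  rwa [ep, lp] at this

end MainSec


section CoverSec

variable [Fintype B] [Finite W] {cs : CoxeterSystem M W}

lemma bruhat_len {v w : W} (h : BruhatLt cs v w) : cs.length v < cs.length w := by
  induction h with
  | single h => exact h.2
  | tail _ h ih => exact ih.trans h.2

lemma pr_inv {p : List (B → ℝ)} (hp : ∀ x ∈ p, IsRoot cs x) : (pr cs p)⁻¹ = pr cs p.reverse := by
  induction p with
  | nil => simp [pr_nil]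
  | cons β p ih =>
    rw [pr_cons, mul_inv_rev, ih (fun x hx => hp x (by simp [hx])), List.reverse_cons, pr_append,
      pr_cons, pr_nil, mul_one, tt_inv (hp β (by simp))]

lemma Good.push_neg {β : B → B → ℝ} {l : List B} {i : B} (h : Good cs β (i :: l)) :
    Pos (rho cs (pr cs (l.map β)) (β i)) := by
  have hn := List.nodup_cons.mp h.nodup
  have hG := h.mono hn.2 (by simp +contextual)
  obtain ⟨c, hc, hs, e⟩ := hG.push (ω := -β i) (by
    intro k hk
    rw [map_neg, LinearMap.neg_apply, neg_nonneg]
    exact h.obt i (by simp) k (by simp [hk]) (by rintro rfl; exact hn.1 hk))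
  have e' : rho cs (pr cs (l.map β)) (β i) = β i + T β c := by
    rw [map_neg] at e
    rw [← neg_neg (rho cs (pr cs (l.map β)) (β i)), e]; abel
  rw [e']
  exact (h.pos i (by simp)).add (Pos.T hG.pos hc hs)

lemma Good.cover {β : B → B → ℝ} {l1 l2 : List B} {i : B} (h : Good cs β (l1 ++ i :: l2)) :
    SqGen cs (pr cs ((l1 ++ l2).map β)) (pr cs ((l1 ++ i :: l2).map β)) := by
  have hnd := h.nodup
  have hperm : (l1 ++ i :: l2).Perm (i :: (l1 ++ l2)) := List.perm_middle
  have hnd' := hperm.nodup_iff.mp hnd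
  have hnd2 := (List.nodup_cons.mp hnd').2
  have hi := (List.nodup_cons.mp hnd').1
  rw [List.mem_append, not_or] at hi
  have hG := h.mono hnd2 (by intro x; simp; tauto)
  have hri := h.root i (by simp)
  have hG1 : Good cs β (i :: l1) := h.mono (List.nodup_cons.mpr ⟨hi.1, (List.nodup_append.mp hnd2).1⟩)
    (by intro x; simp; tauto)
  have hG2 : Good cs β (i :: l2.reverse) := h.mono (List.nodup_cons.mpr ⟨by simpa using hi.2,
    List.nodup_reverse.mpr (List.nodup_append.mp hnd2).2.1⟩) (by intro x; simp; tauto)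
  have hr2 : ∀ x ∈ l2.map β, IsRoot cs x := by
    intro x hx
    obtain ⟨j, hj, rfl⟩ := List.mem_map.mp hx
    exact h.root j (by simp [hj])
  set γ := rho cs (pr cs (l2.map β))⁻¹ (β i) with hγ
  have hγr : IsRoot cs γ := hri.map _
  have hγp : Pos γ := by
    rw [hγ, pr_inv hr2, ← List.map_reverse]
    exact hG2.push_neg
  have htγ : tt cs γ = (pr cs (l2.map β))⁻¹ * tt cs (β i) * pr cs (l2.map β) := by
    rw [hγ, tt_map hri, inv_inv]
  have hv : pr cs ((l1 ++ l2).map β) = pr cs ((l1 ++ i :: l2).map β) * tt cs γ := by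
    rw [htγ]
    simp only [List.map_append, List.map_cons, pr_append, pr_cons]
    have := tt_mul_self hri
    calc _ = pr cs (l1.map β) * (tt cs (β i) * tt cs (β i)) * pr cs (l2.map β) := by
            rw [this]; simp
      _ = _ := by group
  have hneg : Pos (-(rho cs (pr cs ((l1 ++ i :: l2).map β)) γ)) := by
    rw [List.map_append, List.map_cons, pr_append, pr_cons, rho_mul, rho_mul, hγ, rho_inv_self,
      hri.rho_tt, refl_self hri.ne, map_neg, neg_neg]
    exact hG1.push_neg
  have hlen := length_lt_of_neg hγr hγp _ hneg
  rw [← hv] at hlen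
  have hrefl : cs.IsReflection ((pr cs ((l1 ++ l2).map β))⁻¹ * pr cs ((l1 ++ i :: l2).map β)) := by
    have e : (pr cs ((l1 ++ l2).map β))⁻¹ * pr cs ((l1 ++ i :: l2).map β) = tt cs γ := by
      rw [hv, mul_inv_rev, tt_inv hγr]; group
    rw [e]; exact hγr.tt_spec.1
  refine ⟨⟨hrefl, ?_⟩, Relation.TransGen.single ⟨hrefl, hlen⟩⟩
  rw [absLength_ind h.nodup h.ind h.root, absLength_ind hG.nodup hG.ind hG.root]
  simp; omega

lemma Good.delete {β : B → B → ℝ} {l0 : List B} (h : Good cs β l0) (l : List B) :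
    (∀ i ∈ l, i ∈ l0) → ∀ (γ c : B → ℝ), IsRoot cs γ → Pos c → Supp l0 c → γ = T β c →
    Pos (-(rho cs (pr cs (l.map β)) γ)) →
    ∃ l1 i l2, l = l1 ++ i :: l2 ∧ pr cs (l.map β) * tt cs γ = pr cs ((l1 ++ l2).map β) := by
  induction l using List.reverseRecOn with
  | nil =>
    intro _ γ c hγ hc hs e hn
    exfalso
    apply hγ.ne
    refine Pos.eq_zero (e ▸ Pos.T h.pos hc hs) ?_
    simpa [pr_nil] using hn
  | append_singleton l k ih =>
    intro hl γ c hγ hc hs e hn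
    have hk : k ∈ l0 := hl k (by simp)
    have hrk := h.root k hk
    have hpr : pr cs ((l ++ [k]).map β) = pr cs (l.map β) * tt cs (β k) := by
      simp [pr_append, pr_cons, pr_nil]
    have e1 : rho cs (tt cs (β k)) γ = T β (c - (2 * F cs γ (β k) / F cs (β k) (β k)) • sr k) := by
      rw [hrk.rho_tt, refl, map_sub, map_smul, T_sr, ← e]
    set a := 2 * F cs γ (β k) / F cs (β k) (β k) with ha
    have hsupp : Supp l0 (c - a • sr k) := hs.sub ((supp_sr hk).smul a)
    have hr' := hγ.map (tt cs (β k))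
    rcases h.hull _ hr' (mem_sp_map.mpr ⟨_, hsupp, e1⟩) with ⟨d, hd, hds, ed⟩ | ⟨d, hd, hds, ed⟩
    · obtain ⟨l1, i, l2, h1, h2⟩ := ih (fun i hi => hl i (by simp [hi])) _ d hr' hd hds ed (by
        rw [← rho_mul, ← hpr]; exact hn)
      refine ⟨l1, i, l2 ++ [k], by rw [h1]; simp, ?_⟩
      have h3 : pr cs ((l1 ++ (l2 ++ [k])).map β) = pr cs ((l1 ++ l2).map β) * tt cs (β k) := by
        simp [pr_append, pr_cons, pr_nil, mul_assoc]
      rw [h3, ← h2, hpr, tt_map hγ]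
      group
    · have e2 : d = (-1 : ℝ) • (c - a • sr k) := h.ind.eq hds (hsupp.smul _) (by
        rw [map_smul, ← e1, ← ed]; module)
      have e3 : c = c k • sr k := by
        funext b
        by_cases hb : b = k
        · subst hb; simp [sr_self]
        · have h1 := congrFun e2 b
          simp [sr_of_ne hb] at h1
          have h2 := hd b
          have h3 := hc b
          simp [sr_of_ne hb]
          linarith
      have e4 : γ = c k • β k := by
        rw [e]; conv_lhs => rw [e3]
        rw [map_smul, T_sr]
      refine ⟨l, k, [], rfl, ?_⟩
      rw [hpr, tt_smul hγ hrk e4, mul_assoc, tt_mul_self hrk]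
      simp

lemma Good.cover_iff {β : B → B → ℝ} {l : List B} (h : Good cs β l) {v : W}
    (hv : SqGen cs v (pr cs (l.map β))) :
    ∃ l1 i l2, l = l1 ++ i :: l2 ∧ v = pr cs ((l1 ++ l2).map β) := by
  obtain ⟨⟨hr, habs⟩, hb⟩ := hv
  have hlen := bruhat_len hb
  obtain ⟨γ, hγ, hγp, ht⟩ := exists_root hr
  set w := pr cs (l.map β) with hw
  have hwv : w * tt cs γ = v := by
    have : tt cs γ = w⁻¹ * v := by rw [← tt_inv hγ, ht]; group
    rw [this]; group
  have hvw : v * tt cs γ = w := by rw [ht]; group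
  have hneg := neg_of_length_lt hγ hγp w (by rw [hwv]; exact hlen)
  obtain ⟨p, hp, lp, ep⟩ := exists_factor cs v
  have hpw : pr cs (p ++ [γ]) = w := by rw [pr_append, ep, pr_cons, pr_nil, mul_one, hvw]
  obtain ⟨f1, f2⟩ := finrank_mov h.nodup h.ind h.root
  rw [← hw] at f1 f2
  rw [hw, absLength_ind h.nodup h.ind h.root] at habs
  have h3 := (factor_split hp (q := [γ]) (by simpa using hγ) (by
    rw [hpw, f1, habs, lp]; simp)).2
  rw [hpw, f2] at h3
  have hmem : γ ∈ sp (l.map β) := by rw [h3]; exact mem_sp (by simp)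
  rcases h.hull γ hγ hmem with ⟨c, hc, hs, e⟩ | ⟨c, hc, hs, e⟩
  · obtain ⟨l1, i, l2, g1, g2⟩ := h.delete l (fun _ h => h) γ c hγ hc hs e hneg
    exact ⟨l1, i, l2, g1, by rw [← hwv, ← g2]⟩
  · exfalso
    exact hγ.ne (hγp.eq_zero (by rw [e]; exact Pos.T h.pos hc hs))

lemma Good.sublist {β : B → B → ℝ} {l l' : List B} (h : Good cs β l) (hl : l'.Sublist l) :
    Good cs β l' := h.mono (hl.nodup h.nodup) (fun _ hi => hl.subset hi)

lemma Good.sq_sublist {β : B → B → ℝ} {l : List B} (h : Good cs β l) {v : W}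
    (hv : Sq cs v (pr cs (l.map β))) : ∃ l' : List B, l'.Sublist l ∧ v = pr cs (l'.map β) := by
  induction hv using Relation.ReflTransGen.head_induction_on with
  | refl => exact ⟨l, List.Sublist.refl _, rfl⟩
  | head h1 _ ih =>
    obtain ⟨l', hl', rfl⟩ := ih
    obtain ⟨l1, i, l2, rfl, rfl⟩ := (h.sublist hl').cover_iff h1
    refine ⟨l1 ++ l2, List.Sublist.trans ?_ hl', rfl⟩
    exact List.Sublist.append_left (List.sublist_cons_self i l2) l1

lemma Good.sublist_sq_aux {β : B → B → ℝ} {l l' : List B} (hl : l'.Sublist l) :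
    ∀ A : List B, Good cs β (A ++ l) → Sq cs (pr cs ((A ++ l').map β)) (pr cs ((A ++ l).map β)) := by
  induction hl with
  | slnil => intro A _; exact Relation.ReflTransGen.refl
  | @cons l1 l2 a _ ih =>
    intro A h
    exact Relation.ReflTransGen.tail
      (ih A (h.sublist (List.Sublist.append_left (List.sublist_cons_self a l2) A))) h.cover
  | @cons_cons l1 l2 a _ ih =>
    intro A h
    have := ih (A ++ [a]) (by simpa using h)
    simpa using this

lemma Good.sublist_sq {β : B → B → ℝ} {l l' : List B} (h : Good cs β l) (hl : l'.Sublist l) :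
    Sq cs (pr cs (l'.map β)) (pr cs (l.map β)) := by
  simpa using Good.sublist_sq_aux hl [] h

lemma Good.subset_of_eq {β : B → B → ℝ} {l l' l'' : List B} (h : Good cs β l)
    (h1 : l'.Sublist l) (h2 : l''.Sublist l) (e : pr cs (l'.map β) = pr cs (l''.map β)) :
    l' ⊆ l'' := by
  intro i hi
  have g1 := (finrank_mov (h.sublist h1).nodup (h.sublist h1).ind (h.sublist h1).root).2
  have g2 := (finrank_mov (h.sublist h2).nodup (h.sublist h2).ind (h.sublist h2).root).2
  have hm : β i ∈ sp (l''.map β) := by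
    rw [← g2, ← e, g1]; exact mem_sp (List.mem_map_of_mem hi)
  obtain ⟨c, hc, ec⟩ := mem_sp_map.mp hm
  have : sr i = c := h.ind.eq (supp_sr (h1.subset hi)) (hc.mono (fun _ hx => h2.subset hx))
    (by rw [T_sr, ec])
  by_contra hcon
  have h0 := hc i hcon
  rw [← this, sr_self] at h0
  exact one_ne_zero h0

lemma sublist_eq_filter [DecidableEq B] {l l' : List B} (hn : l.Nodup) (h : l'.Sublist l) :
    l' = l.filter (fun b => decide (b ∈ l')) := by
  induction h with
  | slnil => rfl
  | @cons l1 l2 a h ih =>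
    have hn' := List.nodup_cons.mp hn
    rw [List.filter_cons_of_neg (by simpa using fun ha => hn'.1 (h.subset ha))]
    exact ih hn'.2
  | @cons_cons l1 l2 a h ih =>
    have hn' := List.nodup_cons.mp hn
    rw [List.filter_cons_of_pos (by simp)]
    congr 1
    refine (ih hn'.2).trans ?_
    apply List.filter_congr
    intro x hx
    have : x ≠ a := by rintro rfl; exact hn'.1 hx
    simp [this]

theorem boolean_aux {w : W} {n : ℕ} (hw : GoodW cs w n) :
    ∃ ψ : Finset (Fin n) ≃ {v : W // Sq cs v w},
      (∀ J J', Sq cs (ψ J).1 (ψ J').1 ↔ J ⊆ J') ∧ ∀ J, absLength cs (ψ J).1 = J.card := by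
  classical
  obtain ⟨β, l, h, rfl, rfl⟩ := hw
  set L : Finset (Fin l.length) → List B :=
    fun J => l.filter (fun b => decide (b ∈ J.image l.get)) with hL
  have hsub : ∀ J, (L J).Sublist l := fun J => List.filter_sublist
  have hget : Function.Injective l.get := List.nodup_iff_injective_get.mp h.nodup
  have hmem : ∀ J k, l.get k ∈ L J ↔ k ∈ J := by
    intro J k
    simp only [hL, List.mem_filter, decide_eq_true_eq, List.get_mem, true_and]
    exact hget.mem_finset_image
  have hmemJ : ∀ J b, b ∈ L J ↔ b ∈ J.image l.get := by
    intro J b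
    simp only [hL, List.mem_filter, decide_eq_true_eq]
    refine ⟨fun hh => hh.2, fun hh => ⟨?_, hh⟩⟩
    obtain ⟨k, _, rfl⟩ := Finset.mem_image.mp hh
    exact List.get_mem l k
  have hord : ∀ J J', Sq cs (pr cs ((L J).map β)) (pr cs ((L J').map β)) ↔ J ⊆ J' := by
    intro J J'
    constructor
    · intro hs k hk
      obtain ⟨m, hm, e⟩ := (h.sublist (hsub J')).sq_sublist hs
      have := h.subset_of_eq (hsub J) (hm.trans (hsub J')) e ((hmem J k).mpr hk)
      exact (hmem J' k).mp (hm.subset this)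
    · intro hJ
      apply (h.sublist (hsub J')).sublist_sq
      apply List.monotone_filter_right
      intro b hb
      rw [decide_eq_true_eq] at hb ⊢
      exact Finset.image_subset_image hJ hb
  set ψ : Finset (Fin l.length) → {v : W // Sq cs v (pr cs (l.map β))} :=
    fun J => ⟨pr cs ((L J).map β), h.sublist_sq (hsub J)⟩ with hψ
  have hbij : Function.Bijective ψ := by
    constructor
    · intro J J' e
      have e' : pr cs ((L J).map β) = pr cs ((L J').map β) := congrArg Subtype.val e
      apply Finset.Subset.antisymm
      · intro k hk
        exact (hmem J' k).mp (h.subset_of_eq (hsub J) (hsub J') e' ((hmem J k).mpr hk))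
      · intro k hk
        exact (hmem J k).mp (h.subset_of_eq (hsub J') (hsub J) e'.symm ((hmem J' k).mpr hk))
    · rintro ⟨v, hv⟩
      obtain ⟨l', hl', rfl⟩ := h.sq_sublist hv
      refine ⟨Finset.univ.filter (fun k => l.get k ∈ l'), ?_⟩
      apply Subtype.ext
      simp only [hψ]
      congr 2
      rw [sublist_eq_filter h.nodup hl']
      apply List.filter_congr
      intro b hb
      obtain ⟨k, rfl⟩ := List.get_of_mem hb
      rw [decide_eq_decide, hget.mem_finset_image, ← sublist_eq_filter h.nodup hl']
      simp
  refine ⟨Equiv.ofBijective ψ hbij, hord, ?_⟩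
  intro J
  have hg := h.sublist (hsub J)
  change absLength cs (pr cs ((L J).map β)) = _
  rw [absLength_ind hg.nodup hg.ind hg.root, ← List.toFinset_card_of_nodup hg.nodup]
  have : (L J).toFinset = J.image l.get := by ext b; rw [List.mem_toFinset, hmemJ]
  rw [this, Finset.card_image_of_injective _ hget]

end CoverSec


section CountSec

variable [Fintype B] [Finite W] {cs : CoxeterSystem M W}

lemma card_below {w : W} (hw : GoodW cs w (absLength cs w)) (k : ℕ) :
    Nat.card {v : W // Sq cs v w ∧ absLength cs w = absLength cs v + k} =
      (absLength cs w).choose k := by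
  classical
  generalize absLength cs w = r at hw ⊢
  obtain ⟨ψ, -, hcard⟩ := boolean_aux hw
  have e1 : {J : Finset (Fin r) // r = J.card + k} ≃
      {v : W // Sq cs v w ∧ r = absLength cs v + k} :=
    (ψ.subtypeEquiv (q := fun v => r = absLength cs v.1 + k)
      (fun J => by rw [hcard])).trans
      (Equiv.subtypeSubtypeEquivSubtypeInter (fun v => Sq cs v w)
        (fun v => r = absLength cs v + k))
  rw [← Nat.card_congr e1]
  rw [Nat.card_eq_fintype_card, Fintype.card_subtype]
  by_cases hk : k ≤ r
  · have : (Finset.univ.filter (fun J : Finset (Fin r) => r = J.card + k)) =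
        Finset.powersetCard (r - k) Finset.univ := by
      ext J
      simp only [Finset.mem_filter, Finset.mem_univ, true_and, Finset.mem_powersetCard,
        Finset.subset_univ]
      omega
    rw [this, Finset.card_powersetCard, Finset.card_univ, Fintype.card_fin, Nat.choose_symm hk]
  · rw [Nat.choose_eq_zero_of_lt (by omega), Finset.card_eq_zero, Finset.filter_eq_empty_iff]
    intro J _
    omega

lemma count_aux {c : W} (hc : IsStdCoxeterElement cs c) (k : ℕ) :
    Nat.card {p : W × W // AbsLe cs p.2 c ∧ Sq cs p.1 p.2 ∧
          absLength cs p.2 = absLength cs p.1 + k} =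
        ∑ r ∈ Finset.Icc k (Fintype.card B),
          Nat.card {w : W // AbsLe cs w c ∧ absLength cs w = r} * r.choose k := by
  classical
  have := Fintype.ofFinite W
  let e : {p : W × W // AbsLe cs p.2 c ∧ Sq cs p.1 p.2 ∧ absLength cs p.2 = absLength cs p.1 + k} ≃
      Σ w : {w : W // AbsLe cs w c}, {v : W // Sq cs v w.1 ∧ absLength cs w.1 = absLength cs v + k} :=
    { toFun := fun p => ⟨⟨p.1.2, p.2.1⟩, ⟨p.1.1, p.2.2⟩⟩
      invFun := fun x => ⟨(x.2.1, x.1.1), x.1.2, x.2.2⟩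
      left_inv := fun _ => rfl
      right_inv := fun _ => rfl }
  rw [Nat.card_congr e, Nat.card_sigma]
  have h1 : ∀ w : {w : W // AbsLe cs w c},
      Nat.card {v : W // Sq cs v w.1 ∧ absLength cs w.1 = absLength cs v + k} =
        (absLength cs w.1).choose k := fun w => card_below (nc_good hc w.2) k
  rw [Finset.sum_congr rfl (fun w _ => h1 w)]
  have hsub : Finset.Icc k (Fintype.card B) ⊆ Finset.range (Fintype.card B + 1) := by
    intro x hx
    rw [Finset.mem_Icc] at hx
    rw [Finset.mem_range]; omega
  rw [Finset.sum_subset hsub (by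
    intro x hx hx'
    rw [Finset.mem_Icc] at hx'
    rw [Finset.mem_range] at hx
    rw [Nat.choose_eq_zero_of_lt (by omega), mul_zero])]
  rw [← Finset.sum_fiberwise_of_maps_to (s := Finset.univ) (t := Finset.range (Fintype.card B + 1))
    (g := fun w : {w : W // AbsLe cs w c} => absLength cs w.1) (by
      intro w _
      rw [Finset.mem_range, ← absLength_cox hc]
      have := w.2
      unfold AbsLe at this
      omega)]
  apply Finset.sum_congr rfl
  intro r _
  rw [Finset.sum_congr rfl (g := fun _ => r.choose k) (by
    intro w hw
    rw [(Finset.mem_filter.mp hw).2])]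
  rw [Finset.sum_const, smul_eq_mul]
  congr 1
  rw [← Nat.card_congr (Equiv.subtypeSubtypeEquivSubtypeInter (fun w => AbsLe cs w c)
        (fun w => absLength cs w = r)), Nat.card_eq_fintype_card, Fintype.card_subtype]

end CountSec

/-- For `w ∈ NC(W,c)` of rank `r`, the lower ideal of `w` for `⊏` is a Boolean
lattice with `2^r` elements; consequently the number of intervals of height `k`
for `⊏` is `∑_{r=k}^n Nar_r(W) · C(r,k)`. -/
theorem stmt18 [Finite W] [Fintype B] (cs : CoxeterSystem M W) (c : W)
    (hc : IsStdCoxeterElement cs c) :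
    (∀ w : W, AbsLe cs w c →
      ∃ φ : {v : W // Sq cs v w} ≃ Finset (Fin (absLength cs w)),
        ∀ v v' : {v : W // Sq cs v w}, Sq cs v.1 v'.1 ↔ φ v ⊆ φ v') ∧
    (∀ k : ℕ,
      Nat.card {p : W × W // AbsLe cs p.2 c ∧ Sq cs p.1 p.2 ∧
          absLength cs p.2 = absLength cs p.1 + k} =
        ∑ r ∈ Finset.Icc k (Fintype.card B),
          Nat.card {w : W // AbsLe cs w c ∧ absLength cs w = r} * r.choose k) := by
  refine ⟨fun w hw => ?_, count_aux hc⟩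
  obtain ⟨ψ, hψ, -⟩ := boolean_aux (nc_good hc hw)
  refine ⟨ψ.symm, fun v v' => ?_⟩
  rw [← hψ, Equiv.apply_symm_apply, Equiv.apply_symm_apply]

end NCpaper
end

section
/- Let W be a finite Weyl group (or more generally a finite Coxeter group) of rank n with degrees d₁,…,d_n and Coxeter number h. The number of reflections t ∈ T with full support (supp(t) = S) equals (n·h / |W|) · ∏_{i=2}^{n} (e_i − 1), where e_i = d_i − 1 are the exponents, assuming the known formula M(W,q) = (n!/|W|) ∏_{i=1}^n (d_i + q(h − d_i)) for the generating polynomial of maximal chains in NC(W,c) by the number of ≪·-covers, together with the fact that for each full reflection t, the interval {w : t ≪ w ≪ c} is a Boolean lattice of rank n−1. -/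
namespace NCpaper

open CoxeterSystem

variable {B : Type*} {W : Type*} [Group W] {M : CoxeterMatrix B}

variable [Finite W]

/-- A maximal chain `e = f 0 ⋖ f 1 ⋖ … ⋖ f n = c` in the noncrossing partition
lattice `NC(W,c)`. -/
noncomputable def IsMaxChain (cs : CoxeterSystem M W) (c : W) (n : ℕ)
    (f : Fin (n + 1) → W) : Prop :=
  f 0 = 1 ∧ f (Fin.last n) = c ∧
    ∀ i : Fin n, AbsCovBy cs (f i.castSucc) (f i.succ) ∧ AbsLe cs (f i.succ) c

/-- The number of `≪·`-covers (Bruhat-decreasing covers) along a chain. -/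
noncomputable def nir (cs : CoxeterSystem M W) (n : ℕ) (f : Fin (n + 1) → W) : ℕ :=
  Nat.card {i : Fin n // BruhatLt cs (f i.succ) (f i.castSucc)}

/-- The sign-twisted conjugation action of a simple reflection. -/
def flipFun (cs : CoxeterSystem M W) [DecidableEq W] (i : B) (p : W × ZMod 2) : W × ZMod 2 :=
  (cs.simple i * p.1 * cs.simple i, p.2 + if p.1 = cs.simple i then 1 else 0)

theorem flipFun_involutive (cs : CoxeterSystem M W) [DecidableEq W] (i : B) :
    Function.Involutive (flipFun cs i) := by
  rintro ⟨t, e⟩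
  have h1 : cs.simple i * t * cs.simple i = cs.simple i ↔ t = cs.simple i := by
    constructor
    · intro h
      have := congrArg (fun x => cs.simple i * x * cs.simple i) h
      simpa [mul_assoc] using this
    · rintro rfl; simp
  simp only [flipFun, h1]
  ext
  · simp [mul_assoc]
  · by_cases h : t = cs.simple i
    · simp only [h, if_true, add_assoc]
      rw [show (1 + 1 : ZMod 2) = 0 from rfl, add_zero]
    · simp [h]

/-- The involution as a permutation. -/
def flipPerm (cs : CoxeterSystem M W) [DecidableEq W] (i : B) : Equiv.Perm (W × ZMod 2) :=
  (flipFun_involutive cs i).toPerm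

theorem flipPerm_apply (cs : CoxeterSystem M W) [DecidableEq W] (i : B) (t : W) (e : ZMod 2) :
    flipPerm cs i (t, e) =
      (cs.simple i * t * cs.simple i, e + if t = cs.simple i then 1 else 0) := rfl

theorem flip_pow (cs : CoxeterSystem M W) [DecidableEq W] (i j : B) (k : ℕ) (t : W) (e : ZMod 2) :
    ((flipPerm cs i * flipPerm cs j) ^ k) (t, e) =
      ((cs.simple i * cs.simple j) ^ k * t * (cs.simple j * cs.simple i) ^ k,
        e + ∑ p ∈ Finset.range (2 * k),
          if t = (cs.simple j * cs.simple i) ^ p * cs.simple j then 1 else 0) := by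
  induction k with
  | zero => simp
  | succ k ih =>
    have hinv : (cs.simple i * cs.simple j) ^ k = ((cs.simple j * cs.simple i) ^ k)⁻¹ := by
      rw [← inv_pow]; simp
    set x := cs.simple j * cs.simple i with hx
    have hsw : ∀ q : ℕ, cs.simple j * (x ^ q)⁻¹ = x ^ q * cs.simple j := by
      intro q
      induction q with
      | zero => simp
      | succ q ihq =>
        rw [pow_succ', mul_inv_rev, ← mul_assoc, ihq, ← pow_succ', pow_succ, hx]
        simp [mul_assoc]
    have e1 : (cs.simple i * cs.simple j) ^ k * t * x ^ k = cs.simple j ↔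
        t = x ^ (2 * k) * cs.simple j := by
      rw [hinv, mul_assoc, inv_mul_eq_iff_eq_mul, ← eq_mul_inv_iff_mul_eq, mul_assoc, hsw,
        ← mul_assoc, ← pow_add, two_mul]
    have e2 : cs.simple j * ((cs.simple i * cs.simple j) ^ k * t * x ^ k) * cs.simple j
        = cs.simple i ↔ t = x ^ (2 * k + 1) * cs.simple j := by
      have : cs.simple j * ((cs.simple i * cs.simple j) ^ k * t * x ^ k) * cs.simple j
        = cs.simple i ↔ (cs.simple i * cs.simple j) ^ k * t * x ^ k = x * cs.simple j := by
        constructor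
        · intro h
          have h' := congrArg (fun y => cs.simple j * y * cs.simple j) h
          rw [hx, ← h']; simp [mul_assoc, ← hx]
        · intro h
          rw [h, hx]; simp [mul_assoc]
      rw [this, hinv, mul_assoc, inv_mul_eq_iff_eq_mul, ← eq_mul_inv_iff_mul_eq, mul_assoc,
        mul_assoc, hsw, ← mul_assoc, ← mul_assoc, ← pow_succ, ← pow_add]
      rw [show k + 1 + k = 2 * k + 1 by ring]
    rw [pow_succ', Equiv.Perm.mul_apply, ih, Equiv.Perm.mul_apply, flipPerm_apply, flipPerm_apply]
    rw [show 2 * (k + 1) = 2 * k + 1 + 1 by ring, Finset.sum_range_succ, Finset.sum_range_succ]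
    simp only [e1, e2]
    ext
    · rw [pow_succ' (cs.simple i * cs.simple j), hx]
      simp only [mul_assoc]
      rw [pow_succ (cs.simple j * cs.simple i) k]
    · simp only [add_assoc]

theorem flip_liftable (cs : CoxeterSystem M W) [DecidableEq W] :
    M.IsLiftable (flipPerm cs) := by
  intro i j
  ext1 ⟨t, e⟩
  rw [flip_pow, cs.simple_mul_simple_pow, cs.simple_mul_simple_pow', two_mul,
    Finset.sum_range_add]
  simp only [pow_add, cs.simple_mul_simple_pow', one_mul]
  rw [CharTwo.add_self_eq_zero]
  simp

/-- The resulting permutation representation. -/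
def flipRep (cs : CoxeterSystem M W) [DecidableEq W] : W →* Equiv.Perm (W × ZMod 2) :=
  cs.lift ⟨flipPerm cs, flip_liftable cs⟩

theorem flipRep_simple (cs : CoxeterSystem M W) [DecidableEq W] (i : B) :
    flipRep cs (cs.simple i) = flipPerm cs i :=
  cs.lift_apply_simple (flip_liftable cs) i

theorem flipRep_word (cs : CoxeterSystem M W) [DecidableEq W] (l : List B) (t : W) (e : ZMod 2) :
    flipRep cs (cs.wordProd l) (t, e) =
      (cs.wordProd l * t * (cs.wordProd l)⁻¹, e + ((cs.rightInvSeq l).count t : ℕ)) := by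
  induction l with
  | nil => simp
  | cons i l ih =>
    rw [cs.wordProd_cons, map_mul, Equiv.Perm.mul_apply, ih, flipRep_simple, flipPerm_apply]
    have : cs.wordProd l * t * (cs.wordProd l)⁻¹ = cs.simple i ↔
        (cs.wordProd l)⁻¹ * cs.simple i * cs.wordProd l = t := by
      constructor
      · intro h; rw [← h]; group
      · intro h; rw [← h]; group
    ext
    · simp [mul_assoc]
    · simp only [this, rightInvSeq, List.count_cons, beq_iff_eq]
      push_cast
      rw [add_assoc]

/-- The reflection cocycle. -/
def eta (cs : CoxeterSystem M W) [DecidableEq W] (w t : W) : ZMod 2 := (flipRep cs w (t, 0)).2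

theorem flipRep_eq (cs : CoxeterSystem M W) [DecidableEq W] (w t : W) (e : ZMod 2) :
    flipRep cs w (t, e) = (w * t * w⁻¹, e + eta cs w t) := by
  obtain ⟨l, rfl⟩ := cs.wordProd_surjective w
  rw [eta, flipRep_word, flipRep_word]; simp

theorem eta_word (cs : CoxeterSystem M W) [DecidableEq W] (l : List B) (t : W) :
    eta cs (cs.wordProd l) t = ((cs.rightInvSeq l).count t : ℕ) := by
  rw [eta, flipRep_word]; simp

theorem eta_mul (cs : CoxeterSystem M W) [DecidableEq W] (u v t : W) :
    eta cs (u * v) t = eta cs v t + eta cs u (v * t * v⁻¹) := by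
  rw [eta, map_mul, Equiv.Perm.mul_apply, flipRep_eq, flipRep_eq]; simp

theorem eta_refl (cs : CoxeterSystem M W) [DecidableEq W] (t : W) (ht : cs.IsReflection t) :
    eta cs t t = 1 := by
  obtain ⟨w, i, rfl⟩ := ht
  have h1 : eta cs (cs.simple i) (cs.simple i) = 1 := by
    rw [eta, flipRep_simple, flipPerm_apply]; simp
  have h0 : eta cs (w * w⁻¹) (w * cs.simple i * w⁻¹) = 0 := by
    rw [mul_inv_cancel, eta, map_one]; simp
  rw [eta_mul] at h0
  rw [eta_mul, eta_mul]
  have e1 : w⁻¹ * (w * cs.simple i * w⁻¹) * w⁻¹⁻¹ = cs.simple i := by group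
  rw [e1] at h0
  rw [e1]
  rw [h1]
  have e2 : cs.simple i * cs.simple i * (cs.simple i)⁻¹ = cs.simple i := by group
  rw [e2]
  linear_combination h0

theorem mem_of_eta_ne (cs : CoxeterSystem M W) [DecidableEq W] (l : List B) (t : W)
    (h : eta cs (cs.wordProd l) t ≠ 0) : t ∈ cs.rightInvSeq l := by
  by_contra hn
  rw [eta_word, List.count_eq_zero_of_not_mem hn] at h
  simp at h

/-- Strong exchange, for arbitrary words. -/
theorem strong_exchange (cs : CoxeterSystem M W) (l : List B) (t : W) (ht : cs.IsReflection t)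
    (hlt : cs.length (cs.wordProd l * t) < cs.length (cs.wordProd l)) :
    ∃ j, j < l.length ∧ cs.wordProd l * t = cs.wordProd (l.eraseIdx j) := by
  classical
  have hmem : t ∈ cs.rightInvSeq l := by
    apply mem_of_eta_ne
    intro h0
    obtain ⟨m, hm, hm'⟩ := cs.exists_isReduced (cs.wordProd l * t)
    have h1 : eta cs (cs.wordProd m) t ≠ 0 := by
      rw [← hm', eta_mul, eta_refl cs t ht]
      rw [show t * t * t⁻¹ = t by group, h0]
      simp
    have := (cs.isRightInversion_of_mem_rightInvSeq hm (mem_of_eta_ne cs m t h1)).2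
    rw [← hm', mul_assoc, ht.mul_self, mul_one] at this
    omega
  obtain ⟨j, hj, rfl⟩ := List.mem_iff_getElem.mp hmem
  refine ⟨j, by simpa using hj, ?_⟩
  rw [← List.getD_eq_getElem _ 1 hj, cs.wordProd_mul_getD_rightInvSeq]

theorem bruhatGen_word (cs : CoxeterSystem M W) {v w : W} (h : BruhatGen cs v w) (l : List B)
    (hl : cs.wordProd l = w) : ∃ l' : List B, (∀ x ∈ l', x ∈ l) ∧ cs.wordProd l' = v := by
  obtain ⟨hr, hlen⟩ := h
  have hv : w * (v⁻¹ * w) = v := by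
    have h2 := hr.inv
    rw [← h2]; group
  subst hl
  obtain ⟨j, -, hj⟩ := strong_exchange cs l _ hr (by rw [hv]; exact hlen)
  exact ⟨l.eraseIdx j, fun x hx => List.mem_of_mem_eraseIdx hx, by rw [← hj, hv]⟩

theorem bruhatLe_word (cs : CoxeterSystem M W) {v w : W} (h : BruhatLe cs v w) (l : List B)
    (hl : cs.wordProd l = w) : ∃ l' : List B, (∀ x ∈ l', x ∈ l) ∧ cs.wordProd l' = v := by
  unfold BruhatLe at h
  induction h using Relation.ReflTransGen.head_induction_on with
  | refl => exact ⟨l, fun _ h => h, hl⟩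
  | head h1 _ ih =>
    obtain ⟨l1, h2, h3⟩ := ih
    obtain ⟨l2, h4, h5⟩ := bruhatGen_word cs h1 l1 h3
    exact ⟨l2, fun x hx => h2 x (h4 x hx), h5⟩

/-- Every word contains letters for a reduced word. -/
theorem exists_reduced_sub (cs : CoxeterSystem M W) (l : List B) :
    ∃ l' : List B, (∀ x ∈ l', x ∈ l) ∧ cs.wordProd l' = cs.wordProd l ∧ cs.IsReduced l' := by
  induction l using List.reverseRecOn with
  | nil => exact ⟨[], by simp, rfl, by simp [CoxeterSystem.IsReduced]⟩
  | append_singleton l i ih =>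
    obtain ⟨m, hm, hp, hr⟩ := ih
    have hpi : cs.wordProd (l ++ [i]) = cs.wordProd m * cs.simple i := by
      rw [cs.wordProd_append, hp]; simp
    rcases cs.length_mul_simple (cs.wordProd m) i with h | h
    · refine ⟨m ++ [i], ?_, ?_, ?_⟩
      · intro x hx
        rcases List.mem_append.1 hx with hx | hx
        · exact List.mem_append_left _ (hm x hx)
        · exact List.mem_append_right _ hx
      · rw [hpi, cs.wordProd_append]; simp
      · unfold CoxeterSystem.IsReduced
        rw [cs.wordProd_append]
        simp only [cs.wordProd_singleton, List.length_append, List.length_singleton]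
        rw [h, hr.eq]
    · obtain ⟨j, hjl, hj⟩ := strong_exchange cs m _ (cs.isReflection_simple i) (by omega)
      refine ⟨m.eraseIdx j, ?_, ?_, ?_⟩
      · intro x hx
        exact List.mem_append_left _ (hm x (List.mem_of_mem_eraseIdx hx))
      · rw [hpi, hj]
      · unfold CoxeterSystem.IsReduced
        rw [← hj]
        have := List.length_eraseIdx_add_one hjl
        have := hr.eq
        omega

theorem absLength_le_s19 (cs : CoxeterSystem M W) (l : List W) (hl : ∀ t ∈ l, cs.IsReflection t) :
    absLength cs l.prod ≤ l.length :=
  Nat.sInf_le ⟨l, hl, rfl, rfl⟩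

theorem absLength_dup (cs : CoxeterSystem M W) (x y z : List B) (i j : B)
    (hij : cs.simple i = cs.simple j) :
    absLength cs (cs.wordProd (x ++ i :: (y ++ j :: z))) <
      (x ++ i :: (y ++ j :: z)).length := by
  have key : cs.wordProd (x ++ i :: (y ++ j :: z)) =
      (x.map cs.simple ++ ((y.map cs.simple).map (MulAut.conj (cs.simple i)) ++
        z.map cs.simple)).prod := by
    rw [List.prod_append, List.prod_append, List.prod_hom]
    simp [wordProd, hij, mul_assoc]
  rw [key]
  refine lt_of_le_of_lt (absLength_le_s19 cs _ ?_) ?_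
  · intro t ht
    simp only [List.mem_append, List.mem_map] at ht
    rcases ht with ⟨a, _, rfl⟩ | ⟨_, ⟨a, _, rfl⟩, rfl⟩ | ⟨a, _, rfl⟩
    · exact cs.isReflection_simple a
    · exact (cs.isReflection_simple a).conj _
    · exact cs.isReflection_simple a
  · simp only [List.length_append, List.length_map, List.length_cons]
    omega

/-- If a word using every letter exactly once has full absolute length, then its product
cannot be written avoiding a letter. -/
theorem mem_of_coxeter (cs : CoxeterSystem M W) (l : List B) (hnd : l.Nodup)
    (hall : ∀ i : B, i ∈ l) (habs : absLength cs (cs.wordProd l) = l.length)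
    (m : List B) (hm : cs.wordProd m = cs.wordProd l) (i : B) : i ∈ m := by
  by_contra hi
  obtain ⟨a, b, rfl⟩ := List.append_of_mem (hall i)
  have hia : i ∉ a ∧ i ∉ b := by
    rw [List.nodup_append] at hnd
    exact ⟨fun h => hnd.2.2 i h i (by simp) rfl, (List.nodup_cons.1 hnd.2.1).1⟩
  have hs : cs.wordProd (a.reverse ++ (m ++ b.reverse)) = cs.simple i := by
    rw [cs.wordProd_append, cs.wordProd_append, hm, cs.wordProd_append, cs.wordProd_cons,
      cs.wordProd_reverse, cs.wordProd_reverse]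
    group
  obtain ⟨r, hr1, hr2, hr3⟩ := exists_reduced_sub cs (a.reverse ++ (m ++ b.reverse))
  have hlen : r.length = 1 := by
    rw [← hr3.eq, hr2, hs, cs.length_simple]
  obtain ⟨j, rfl⟩ := List.length_eq_one_iff.1 hlen
  have hj := hr1 j (by simp)
  have hji : j ≠ i := by
    rintro rfl
    simp [hia.1, hia.2, hi] at hj
  have hsij : cs.simple j = cs.simple i := by
    rw [← hs, ← hr2]; simp
  have hjl := hall j
  rw [List.mem_append, List.mem_cons] at hjl
  rcases hjl with h | h | h
  · obtain ⟨x, y, rfl⟩ := List.append_of_mem h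
    have := absLength_dup cs x y b j i hsij
    rw [List.append_assoc, List.cons_append] at habs
    omega
  · exact hji h
  · obtain ⟨x, y, rfl⟩ := List.append_of_mem h
    have := absLength_dup cs a x y i j hsij.symm
    omega

theorem absLength_one (cs : CoxeterSystem M W) : absLength cs (1 : W) = 0 := by
  have := absLength_le_s19 cs [] (by simp)
  simpa using this

theorem absLength_chain (cs : CoxeterSystem M W) (c : W) (n : ℕ) (f : Fin (n + 1) → W)
    (hf : IsMaxChain cs c n f) : absLength cs c = n := by
  have : ∀ k : Fin (n + 1), absLength cs (f k) = k := by
    intro k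
    induction k using Fin.induction with
    | zero => rw [hf.1, absLength_one]; rfl
    | succ k ih => rw [(hf.2.2 k).1.2, ih]; simp
  rw [← hf.2.1, this]; simp

theorem bruhatLt_length (cs : CoxeterSystem M W) {v w : W} (h : BruhatLt cs v w) :
    cs.length v < cs.length w := by
  unfold BruhatLt at h
  induction h with
  | single h => exact h.2
  | tail _ h ih => exact ih.trans h.2

/-- A chain with `n - 1` Bruhat-decreasing covers starts at a full reflection. -/
theorem full_of_chain [Fintype B] (cs : CoxeterSystem M W) (c : W)
    (hc : IsStdCoxeterElement cs c) (m : ℕ) (hrank : Fintype.card B = m + 1)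
    (f : Fin (m + 1 + 1) → W) (hf : IsMaxChain cs c (m + 1) f) (hnir : nir cs (m + 1) f = m) :
    cs.IsReflection (f 1) ∧ supp cs (f 1) = Set.univ := by
  classical
  have hf0 : ¬ BruhatLt cs (f (Fin.succ (0 : Fin (m + 1)))) (f (Fin.castSucc (0 : Fin (m + 1)))) := by
    intro h
    have := bruhatLt_length cs h
    rw [Fin.castSucc_zero, hf.1, cs.length_one] at this
    omega
  have hP : ∀ i : Fin (m + 1), i ≠ 0 → BruhatLt cs (f i.succ) (f i.castSucc) := by
    intro i hi
    by_contra hcon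
    unfold nir at hnir
    rw [Nat.card_eq_fintype_card, Fintype.card_subtype] at hnir
    have hsub : (Finset.univ.filter fun i : Fin (m + 1) =>
        BruhatLt cs (f i.succ) (f i.castSucc)) ⊆ Finset.univ \ {i, 0} := by
      intro k hk
      simp only [Finset.mem_filter, Finset.mem_univ, true_and] at hk
      simp only [Finset.mem_sdiff, Finset.mem_univ, true_and, Finset.mem_insert,
        Finset.mem_singleton, not_or]
      exact ⟨fun h => hcon (h ▸ hk), fun h => hf0 (h ▸ hk)⟩
    have h1 := Finset.card_le_card hsub
    rw [Finset.card_sdiff_of_subset (Finset.subset_univ _), Finset.card_pair hi,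
      Finset.card_univ, Fintype.card_fin, hnir] at h1
    have : 0 < i.val := Nat.pos_of_ne_zero fun h => hi (Fin.ext h)
    have := i.isLt
    omega
  have hle : ∀ k : Fin (m + 1), BruhatLe cs (f k.succ) (f 1) := by
    intro k
    induction k using Fin.induction with
    | zero => exact Relation.ReflTransGen.refl
    | succ k ih =>
      have h1 := hP k.succ (Fin.succ_ne_zero k)
      have h2 : BruhatLe cs (f k.succ.succ) (f k.succ.castSucc) := h1.to_reflTransGen
      rw [← Fin.succ_castSucc] at h2
      exact Relation.ReflTransGen.trans h2 ih
  refine ⟨?_, ?_⟩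
  · have := (hf.2.2 0).1.1
    rw [Fin.castSucc_zero, hf.1] at this
    simpa using this
  · obtain ⟨l, hnd, hall, hlc⟩ := hc
    have hlast := hle (Fin.last m)
    rw [Fin.succ_last, hf.2.1] at hlast
    have hll : l.length = m + 1 := by
      rw [← hrank, ← List.toFinset_card_of_nodup hnd, ← Finset.card_univ]
      congr 1
      ext i; simp [hall i]
    ext i
    simp only [Set.mem_univ, iff_true]
    intro r _ hr
    obtain ⟨r', h1, h2⟩ := bruhatLe_word cs hlast r hr
    refine h1 i (mem_of_coxeter cs l hnd hall ?_ r' (h2.trans hlc.symm) i)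
    rw [hlc, hll]
    exact absLength_chain cs c _ f hf

theorem card_chains [Fintype B] (cs : CoxeterSystem M W) (c : W)
    (hc : IsStdCoxeterElement cs c) (m : ℕ) (hrank : Fintype.card B = m + 1)
    (hBool : ∀ t : W, cs.IsReflection t → supp cs t = Set.univ →
      Nat.card {f : Fin (m + 1 + 1) → W //
          IsMaxChain cs c (m + 1) f ∧ f 1 = t ∧ nir cs (m + 1) f = m} = Nat.factorial m) :
    Nat.card {f : Fin (m + 1 + 1) → W // IsMaxChain cs c (m + 1) f ∧ nir cs (m + 1) f = m} =
      Nat.card {t : W // cs.IsReflection t ∧ supp cs t = Set.univ} * Nat.factorial m := by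
  classical
  let e : {f : Fin (m + 1 + 1) → W // IsMaxChain cs c (m + 1) f ∧ nir cs (m + 1) f = m} ≃
      (Σ t : {t : W // cs.IsReflection t ∧ supp cs t = Set.univ},
        {f : Fin (m + 1 + 1) → W //
          IsMaxChain cs c (m + 1) f ∧ f 1 = t.1 ∧ nir cs (m + 1) f = m}) :=
    { toFun := fun f => ⟨⟨f.1 1, full_of_chain cs c hc m hrank f.1 f.2.1 f.2.2⟩,
        ⟨f.1, f.2.1, rfl, f.2.2⟩⟩
      invFun := fun p => ⟨p.2.1, p.2.2.1, p.2.2.2.2⟩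
      left_inv := fun f => rfl
      right_inv := by
        rintro ⟨⟨t, ht⟩, ⟨f, h1, h2, h3⟩⟩
        dsimp only at h2
        subst h2
        rfl }
  haveI := Fintype.ofFinite {t : W // cs.IsReflection t ∧ supp cs t = Set.univ}
  rw [Nat.card_congr e, Nat.card_sigma, Finset.sum_congr rfl
    (fun t _ => hBool t.1 t.2.1 t.2.2), Finset.sum_const, Finset.card_univ,
    Nat.card_eq_fintype_card, smul_eq_mul]

theorem coeff_prod_linear (s : Finset ℕ) (a b : ℕ → ℕ) :
    (∏ i ∈ s, (Polynomial.C (a i) + Polynomial.X * Polynomial.C (b i)) :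
      Polynomial ℕ).coeff s.card = ∏ i ∈ s, b i := by
  have := Polynomial.coeff_prod_of_natDegree_le s
    (fun i => (Polynomial.C (a i) + Polynomial.X * Polynomial.C (b i) : Polynomial ℕ)) 1
    (fun i _ => by compute_degree)
  rw [mul_one] at this
  rw [this]
  simp

/-- Chapoton's formula for the number of reflections with full support:
`Nar₁⁺(W) = (n·h/|W|) ∏_{i=2}^n (eᵢ − 1)`, derived from the known evaluation
`M(W,q) = (n!/|W|) ∏_{i=1}^n (dᵢ + q(h − dᵢ))` of the generating polynomial of
maximal chains of `NC(W,c)` by the number of `≪·`-covers, together with the fact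
that the upper `≪`-ideal of a full reflection is a Boolean lattice of rank `n−1`.
Here `dᵢ = eᵢ + 1` are the degrees and `h` the Coxeter number.  The conclusion is
stated multiplied out: `#{full reflections} · |W| = n·h·∏_{i=2}^n (eᵢ − 1)`. -/
theorem stmt19 [Fintype B] (cs : CoxeterSystem M W) (c : W)
    (hc : IsStdCoxeterElement cs c)
    (n : ℕ) (hn : 1 ≤ n) (hrank : Fintype.card B = n)
    (d : ℕ → ℕ) (h : ℕ)
    (hd1 : d 1 = 2)
    (hdh : ∀ i ∈ Finset.Icc 1 n, d i ≤ h)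
    (hdual : ∀ i ∈ Finset.Icc 1 n, (d i - 1) + (d (n + 1 - i) - 1) = h)
    -- the evaluation of the `M`-polynomial in terms of the degrees:
    (hM : ∀ j : ℕ,
      Nat.card W *
          Nat.card {f : Fin (n + 1) → W // IsMaxChain cs c n f ∧ nir cs n f = j} =
        Nat.factorial n * (∏ i ∈ Finset.Icc 1 n,
          (Polynomial.C (d i) + Polynomial.X * Polynomial.C (h - d i)) :
            Polynomial ℕ).coeff j)
    -- upper `≪`-ideals of full reflections are Boolean of rank `n − 1`:
    (hBool : ∀ t : W, cs.IsReflection t → supp cs t = Set.univ →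
      Nat.card {f : Fin (n + 1) → W //
          IsMaxChain cs c n f ∧ f 1 = t ∧ nir cs n f = n - 1} = Nat.factorial (n - 1)) :
    Nat.card {t : W // cs.IsReflection t ∧ supp cs t = Set.univ} * Nat.card W =
      n * h * ∏ i ∈ Finset.Icc 2 n, (d i - 1 - 1) := by
  obtain ⟨m, rfl⟩ : ∃ m, n = m + 1 := ⟨n - 1, by omega⟩
  simp only [Nat.add_sub_cancel] at hBool
  have hcard := card_chains cs c hc m hrank hBool
  have hMm := hM m
  have hh : 2 ≤ h := hd1 ▸ hdh 1 (by simp)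
  have hdn : d (m + 1) = h := by
    have := hdual 1 (by simp)
    rw [hd1, Nat.add_sub_cancel] at this
    omega
  have hcoeff : (∏ i ∈ Finset.Icc 1 (m + 1),
          (Polynomial.C (d i) + Polynomial.X * Polynomial.C (h - d i)) :
            Polynomial ℕ).coeff m = h * ∏ i ∈ Finset.Icc 1 m, (h - d i) := by
    rw [Finset.prod_Icc_succ_top (by omega), hdn, Nat.sub_self, Polynomial.C_0, mul_zero,
      add_zero, Polynomial.coeff_mul_C, mul_comm]
    congr 1
    have := coeff_prod_linear (Finset.Icc 1 m) d (fun i => h - d i)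
    simpa using this
  have hprod : ∏ i ∈ Finset.Icc 1 m, (h - d i) = ∏ i ∈ Finset.Icc 2 (m + 1), (d i - 1 - 1) := by
    refine Finset.prod_bij' (fun i _ => m + 2 - i) (fun i _ => m + 2 - i) ?_ ?_ ?_ ?_ ?_
    · intro i hi; simp only [Finset.mem_Icc] at *; omega
    · intro i hi; simp only [Finset.mem_Icc] at *; omega
    · intro i hi; simp only [Finset.mem_Icc] at *; omega
    · intro i hi; simp only [Finset.mem_Icc] at *; omega
    · intro i hi
      simp only [Finset.mem_Icc] at hi
      have h1 := hdual i (by simp only [Finset.mem_Icc]; omega)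
      have h2 := hdh (m + 2 - i) (by simp only [Finset.mem_Icc]; omega)
      rw [show m + 1 + 1 - i = m + 2 - i by omega] at h1
      omega
  rw [hcoeff, hprod, hcard, Nat.factorial_succ] at hMm
  have hpos := Nat.factorial_pos m
  refine Nat.eq_of_mul_eq_mul_right hpos ?_
  linarith [hMm]

end NCpaper
end
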